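/- arXiv:1109.5020 — 3 statements merged into one kernel-verified Lean document; each statement's English description precedes it below -/
import Mathlib

section
/- Let k ≥ 1, a ∈ Γ_k, and let u be any nontrivial radial Neumann solution of Δu + a u = 0 on B_1. Then for every i with 1 ≤ i ≤ k, the function u has at least i zeros in the interval [r_i, 1); consequently, if u has finitely many zeros in (0,1) and x_k < x_{k−1} < ⋯ < x_1 denote its k largest zeros, then r_i ≤ x_i for every 1 ≤ i ≤ k. -/
open MeasureTheory Set Filter

noncomputable section

/-- The measure of the (N-1)-dimensional unit sphere in `ℝ^N`. -/
def omegaN (N : ℕ) : ℝ :=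
  N * (volume (Metric.ball (0 : EuclideanSpace ℝ (Fin N)) 1)).toReal

/-- `u` is a radial Neumann solution of `Δu + a u = 0` on the unit ball of `ℝ^N`,
with explicit derivative function `u'` : `u` is continuous on `[0,1]`, differentiable on
`(0,1]`, satisfies the integrated radial equation
`r^(N-1) u'(r) = -∫_0^r s^(N-1) a(s) u(s) ds` on `(0,1]`, and `u'(1) = 0`. -/
def IsRadialNeumannSolutionDeriv (N : ℕ) (a u u' : ℝ → ℝ) : Prop :=
  ContinuousOn u (Icc 0 1) ∧
  (∀ r ∈ Ioc (0:ℝ) 1, HasDerivAt u (u' r) r) ∧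
  (∀ r ∈ Ioc (0:ℝ) 1,
    r ^ (N - 1) * u' r = - ∫ s in (0:ℝ)..r, s ^ (N - 1) * a s * u s) ∧
  u' 1 = 0

/-- `u` is a radial Neumann solution of `Δu + a u = 0` on the unit ball of `ℝ^N`. -/
def IsRadialNeumannSolution (N : ℕ) (a u : ℝ → ℝ) : Prop :=
  ∃ u' : ℝ → ℝ, IsRadialNeumannSolutionDeriv N a u u'

/-- `u` is not identically zero on `[0,1]`. -/
def NontrivialSol (u : ℝ → ℝ) : Prop := ∃ r ∈ Icc (0:ℝ) 1, u r ≠ 0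

/-- `μ ≺ a` : `a(r) ≥ μ` for a.e. `r ∈ (0,1)` and `a(r) > μ` on a set of positive measure. -/
def Prec (μ : ℝ) (a : ℝ → ℝ) : Prop :=
  (∀ᵐ r ∂(volume.restrict (Ioo (0:ℝ) 1)), μ ≤ a r) ∧
  0 < volume {r ∈ Ioo (0:ℝ) 1 | μ < a r}

/-- A radial function `a` belongs to `L^p(B_1)` (finite `p`). -/
def RadialMemLp (N : ℕ) (p : ℝ) (a : ℝ → ℝ) : Prop :=
  IntegrableOn (fun r => r ^ (N - 1) * |a r| ^ p) (Ioo (0:ℝ) 1)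

/-- A radial function `a` belongs to `L^∞(B_1)`. -/
def RadialMemLinfty (a : ℝ → ℝ) : Prop :=
  ∃ C : ℝ, ∀ᵐ r ∂(volume.restrict (Ioo (0:ℝ) 1)), |a r| ≤ C

/-- The `L^p(B_1)` norm of a radial function (finite `p`):
`(ω_N ∫_0^1 r^(N-1) |a(r)|^p dr)^(1/p)`. -/
def radialLpNorm (N : ℕ) (p : ℝ) (a : ℝ → ℝ) : ℝ :=
  (omegaN N * ∫ r in (0:ℝ)..1, r ^ (N - 1) * |a r| ^ p) ^ (1 / p)

/-- The `L^∞(B_1)` norm of a radial function: essential supremum of `|a|` on `(0,1)`. -/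
def radialLinftyNorm (a : ℝ → ℝ) : ℝ :=
  essSup (fun r => |a r|) (volume.restrict (Ioo (0:ℝ) 1))

/-- The admissible class `Γ_k` at level `μk`: radial measurable `a` with `μk ≺ a`, such that
`Δu + a u = 0` has a nontrivial radial Neumann solution, and `a ∈ L^{N/2}(B_1)` if `N ≥ 3`,
or `a ∈ L^q(B_1)` for some `q ∈ (1,∞]` if `N = 2`. -/
def GammaSet (N : ℕ) (μk : ℝ) (a : ℝ → ℝ) : Prop :=
  Measurable a ∧ Prec μk a ∧
  (∃ u : ℝ → ℝ, IsRadialNeumannSolution N a u ∧ NontrivialSol u) ∧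
  (if 3 ≤ N then RadialMemLp N ((N : ℝ) / 2) a
   else (∃ q : ℝ, 1 < q ∧ RadialMemLp N q a) ∨ RadialMemLinfty a)

/-- The Lyapunov constant `γ_{p,k}` for finite `p`. -/
def gammaLyap (N : ℕ) (μk : ℝ) (p : ℝ) : ℝ :=
  sInf {t : ℝ | ∃ a : ℝ → ℝ, GammaSet N μk a ∧ RadialMemLp N p a ∧
    t = radialLpNorm N p (fun r => a r - μk)}

/-- The Lyapunov constant `γ_{∞,k}`. -/
def gammaLyapInfty (N : ℕ) (μk : ℝ) : ℝ :=
  sInf {t : ℝ | ∃ a : ℝ → ℝ, GammaSet N μk a ∧ RadialMemLinfty a ∧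
    t = radialLinftyNorm (fun r => a r - μk)}

/-- `(μ, φ)` is the `k`-th radial Neumann eigenpair of `-Δ` on `B_1 ⊆ ℝ^N`:
`μ ≥ 0`, `φ` is a nontrivial radial Neumann solution of `Δφ + μ φ = 0` having exactly `k`
zeros in `(0,1)`, all simple, given by `rz k < rz (k-1) < ⋯ < rz 1`. -/
def IsRadialNeumannEigenpair (N k : ℕ) (μ : ℝ) (φ : ℝ → ℝ) (rz : ℕ → ℝ) : Prop :=
  0 ≤ μ ∧
  IsRadialNeumannSolution N (fun _ => μ) φ ∧ NontrivialSol φ ∧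
  (∀ i, 1 ≤ i → i ≤ k → rz i ∈ Ioo (0:ℝ) 1) ∧
  (∀ i j, 1 ≤ i → i < j → j ≤ k → rz j < rz i) ∧
  (∀ x ∈ Ioo (0:ℝ) 1, (φ x = 0 ↔ ∃ i, 1 ≤ i ∧ i ≤ k ∧ x = rz i)) ∧
  (∀ i, 1 ≤ i → i ≤ k → ∃ d : ℝ, d ≠ 0 ∧ HasDerivAt φ d (rz i))

/-- `u` (with derivative `u'`) is a radial `H^1` solution of `Δu + a u = 0` in `B_1`:
continuous on `(0,1]`, differentiable on `(0,1)`, satisfying the integrated radial equation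
between any two radii, with finite radial `H^1` energy. -/
def IsRadialH1Solution (N : ℕ) (a u u' : ℝ → ℝ) : Prop :=
  ContinuousOn u (Ioc 0 1) ∧
  (∀ r ∈ Ioo (0:ℝ) 1, HasDerivAt u (u' r) r) ∧
  (∀ s ∈ Ioo (0:ℝ) 1, ∀ r ∈ Ioo (0:ℝ) 1, s < r →
    r ^ (N - 1) * u' r - s ^ (N - 1) * u' s
      = - ∫ t in s..r, t ^ (N - 1) * a t * u t) ∧
  IntegrableOn (fun r => r ^ (N - 1) * ((u' r) ^ 2 + (u r) ^ 2)) (Ioo (0:ℝ) 1)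

/-- The Sobolev quotient: infimum of `(∫_{B_ρ} |∇w|²) / (∫_{B_ρ} |w|^q)^{2/q}` over nontrivial
`C^1` functions `w : ℝ^N → ℝ` with compact support contained in the ball `B_ρ`. -/
def sobolevQuot (N : ℕ) (q : ℝ) (ρ : ℝ) : ℝ :=
  sInf {t : ℝ | ∃ w : EuclideanSpace ℝ (Fin N) → ℝ,
    ContDiff ℝ 1 w ∧ (∃ x, w x ≠ 0) ∧ tsupport w ⊆ Metric.ball 0 ρ ∧
    t = (∫ x in Metric.ball (0 : EuclideanSpace ℝ (Fin N)) ρ, ‖fderiv ℝ w x‖ ^ 2) /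
        (∫ x in Metric.ball (0 : EuclideanSpace ℝ (Fin N)) ρ, |w x| ^ q) ^ (2 / q)}

lemma RadialMemLp.intervalIntegrable {N : ℕ} {q : ℝ} {a : ℝ → ℝ} (hq : 1 ≤ q)
    (ha : Measurable a) (h : RadialMemLp N q a) :
    IntervalIntegrable (fun r => r ^ (N - 1) * a r) volume 0 1 := by
  rw [intervalIntegrable_iff_integrableOn_Ioo_of_le zero_le_one]
  have hpow : IntegrableOn (fun r : ℝ => r ^ (N - 1)) (Ioo (0:ℝ) 1) :=
    ((continuous_pow (N - 1)).integrableOn_Icc (a := (0:ℝ)) (b := 1)).mono_set Ioo_subset_Icc_self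
  refine Integrable.mono' (hpow.add h)
    ((measurable_id.pow_const _).mul ha).aestronglyMeasurable ?_
  filter_upwards [ae_restrict_mem measurableSet_Ioo] with r hr
  have hrN : 0 ≤ r ^ (N - 1) := pow_nonneg hr.1.le _
  have hle : |a r| ≤ 1 + |a r| ^ q := by
    rcases le_total |a r| 1 with h1 | h1
    · linarith [Real.rpow_nonneg (abs_nonneg (a r)) q]
    · linarith [Real.self_le_rpow_of_one_le h1 hq]
  rw [Real.norm_eq_abs, abs_mul, abs_of_nonneg hrN, Pi.add_apply, ← mul_one_add]
  exact mul_le_mul_of_nonneg_left hle hrN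

lemma RadialMemLinfty.intervalIntegrable {N : ℕ} {a : ℝ → ℝ}
    (ha : Measurable a) (h : RadialMemLinfty a) :
    IntervalIntegrable (fun r => r ^ (N - 1) * a r) volume 0 1 := by
  obtain ⟨C, hC⟩ := h
  rw [intervalIntegrable_iff_integrableOn_Ioo_of_le zero_le_one]
  have hpow : IntegrableOn (fun r : ℝ => r ^ (N - 1)) (Ioo (0:ℝ) 1) :=
    ((continuous_pow (N - 1)).integrableOn_Icc (a := (0:ℝ)) (b := 1)).mono_set Ioo_subset_Icc_self
  refine Integrable.mono' (hpow.mul_const C)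
    ((measurable_id.pow_const _).mul ha).aestronglyMeasurable ?_
  filter_upwards [ae_restrict_mem measurableSet_Ioo, hC] with r hr hCr
  have hrN : 0 ≤ r ^ (N - 1) := pow_nonneg hr.1.le _
  rw [Real.norm_eq_abs, abs_mul, abs_of_nonneg hrN]
  exact mul_le_mul_of_nonneg_left hCr hrN

lemma GammaSet.intervalIntegrable {N : ℕ} {μ : ℝ} {a : ℝ → ℝ} (h : GammaSet N μ a) :
    IntervalIntegrable (fun r => r ^ (N - 1) * a r) volume 0 1 := by
  obtain ⟨ha, -, -, h⟩ := h
  split_ifs at h with hN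
  · refine RadialMemLp.intervalIntegrable ?_ ha h
    have : (3:ℝ) ≤ N := by exact_mod_cast hN
    linarith
  · rcases h with ⟨q, hq, h⟩ | h
    · exact h.intervalIntegrable hq.le ha
    · exact h.intervalIntegrable ha

namespace IsRadialNeumannSolutionDeriv

variable {N : ℕ} {a b u u' v v' : ℝ → ℝ} {α β : ℝ}

lemma neg (h : IsRadialNeumannSolutionDeriv N a u u') :
    IsRadialNeumannSolutionDeriv N a (fun r => -u r) (fun r => -u' r) := by
  obtain ⟨hc, hd, hi, h1⟩ := h
  refine ⟨hc.neg, fun r hr => (hd r hr).fun_neg, fun r hr => ?_, by simp [h1]⟩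
  simp only [mul_neg, hi r hr, intervalIntegral.integral_neg]

lemma intervalIntegrable (h : IsRadialNeumannSolutionDeriv N a u u')
    (ha : IntervalIntegrable (fun r => r ^ (N - 1) * a r) volume 0 1) :
    IntervalIntegrable (fun r => r ^ (N - 1) * a r * u r) volume 0 1 :=
  ha.mul_continuousOn (by rw [uIcc_of_le zero_le_one]; exact h.1)

lemma absolutelyContinuous_flux (h : IsRadialNeumannSolutionDeriv N a u u')
    (ha : IntervalIntegrable (fun r => r ^ (N - 1) * a r) volume 0 1) :
    AbsolutelyContinuousOnInterval (fun r => ∫ s in (0:ℝ)..r, s ^ (N - 1) * a s * u s) 0 1 :=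
  (h.intervalIntegrable ha).absolutelyContinuousOnInterval_intervalIntegral left_mem_uIcc

lemma ae_hasDerivAt_flux (h : IsRadialNeumannSolutionDeriv N a u u')
    (ha : IntervalIntegrable (fun r => r ^ (N - 1) * a r) volume 0 1) :
    ∀ᵐ r, r ∈ Icc (0:ℝ) 1 → HasDerivAt (fun r => ∫ s in (0:ℝ)..r, s ^ (N - 1) * a s * u s)
      (r ^ (N - 1) * a r * u r) r := by
  filter_upwards [(h.intervalIntegrable ha).ae_hasDerivAt_integral] with r hr hr'
  rw [← uIcc_of_le zero_le_one] at hr'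
  exact hr hr' 0 left_mem_uIcc

lemma absolutelyContinuous (h : IsRadialNeumannSolutionDeriv N a u u')
    (ha : IntervalIntegrable (fun r => r ^ (N - 1) * a r) volume 0 1)
    (hα : 0 < α) (hαβ : α ≤ β) (hβ : β ≤ 1) : AbsolutelyContinuousOnInterval u α β := by
  have hsub : Icc α β ⊆ Ioc 0 1 := fun r hr => ⟨hα.trans_le hr.1, hr.2.trans hβ⟩
  have hflux := (h.absolutelyContinuous_flux ha).continuousOn
  rw [uIcc_of_le zero_le_one] at hflux
  have hcont : ContinuousOn u' (Icc α β) := by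
    have hquot : ContinuousOn
        (fun r => -(∫ s in (0:ℝ)..r, s ^ (N - 1) * a s * u s) / r ^ (N - 1)) (Icc α β) :=
      (hflux.mono (hsub.trans Ioc_subset_Icc_self)).neg.div (by fun_prop)
        fun r hr => (pow_pos (hsub hr).1 _).ne'
    refine hquot.congr fun r hr => ?_
    dsimp only
    rw [← h.2.2.1 r (hsub hr), mul_div_cancel_left₀ _ (pow_pos (hsub hr).1 _).ne']
  obtain ⟨C, hC⟩ := isCompact_Icc.exists_bound_of_continuousOn hcont
  have hlip : LipschitzOnWith C.toNNReal u (Icc α β) :=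
    (convex_Icc α β).lipschitzOnWith_of_nnnorm_hasDerivWithin_le
      (fun r hr => (h.2.1 r (hsub hr)).hasDerivWithinAt)
      fun r hr => NNReal.coe_le_coe.mp <| by
        simpa using (hC r hr).trans (Real.le_coe_toNNReal C)
  rw [← uIcc_of_le hαβ] at hlip
  exact hlip.absolutelyContinuousOnInterval

/-- The Wronskian of two radial solutions is monotone where both are nonnegative and the
potentials are ordered. -/
lemma wronskian_le (hu : IsRadialNeumannSolutionDeriv N a u u')
    (hv : IsRadialNeumannSolutionDeriv N b v v')
    (ha : IntervalIntegrable (fun r => r ^ (N - 1) * a r) volume 0 1)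
    (hb : IntervalIntegrable (fun r => r ^ (N - 1) * b r) volume 0 1)
    (hba : ∀ᵐ r ∂(volume.restrict (Ioo (0:ℝ) 1)), b r ≤ a r)
    (hα : 0 < α) (hαβ : α ≤ β) (hβ : β ≤ 1)
    (hu0 : ∀ r ∈ Ioo α β, 0 ≤ u r) (hv0 : ∀ r ∈ Ioo α β, 0 ≤ v r) :
    α ^ (N - 1) * (v' α * u α - u' α * v α) ≤ β ^ (N - 1) * (v' β * u β - u' β * v β) := by
  set P : ℝ → ℝ := fun r => ∫ s in (0:ℝ)..r, s ^ (N - 1) * a s * u s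
  set Q : ℝ → ℝ := fun r => ∫ s in (0:ℝ)..r, s ^ (N - 1) * b s * v s
  set W : ℝ → ℝ := fun r => P r * v r - Q r * u r
  have hsub : uIcc α β ⊆ uIcc 0 1 := by
    rw [uIcc_of_le hαβ, uIcc_of_le zero_le_one]
    exact Icc_subset_Icc hα.le hβ
  have hW : AbsolutelyContinuousOnInterval W α β :=
    (((hu.absolutelyContinuous_flux ha).mono hsub).mul
      (hv.absolutelyContinuous hb hα hαβ hβ)).sub
    (((hv.absolutelyContinuous_flux hb).mono hsub).mul
      (hu.absolutelyContinuous ha hα hαβ hβ))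
  have hWeq : ∀ r ∈ Icc α β, W r = r ^ (N - 1) * (v' r * u r - u' r * v r) := fun r hr => by
    have hr' : r ∈ Ioc (0:ℝ) 1 := ⟨hα.trans_le hr.1, hr.2.trans hβ⟩
    have h1 : r ^ (N - 1) * u' r = -P r := hu.2.2.1 r hr'
    have h2 : r ^ (N - 1) * v' r = -Q r := hv.2.2.1 r hr'
    change P r * v r - Q r * u r = _
    linear_combination v r * h1 - u r * h2
  have hint : 0 ≤ ∫ r in α..β, deriv W r := by
    rw [intervalIntegral.integral_of_le hαβ, integral_Ioc_eq_integral_Ioo]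
    refine setIntegral_nonneg_of_ae_restrict ?_
    rw [EventuallyLE, ae_restrict_iff' measurableSet_Ioo]
    filter_upwards [hu.ae_hasDerivAt_flux ha, hv.ae_hasDerivAt_flux hb,
      (ae_restrict_iff' measurableSet_Ioo).mp hba] with r hP hQ hab hr
    have hr' : r ∈ Ioo (0:ℝ) 1 := ⟨hα.trans hr.1, hr.2.trans_le hβ⟩
    have hr'' := Ioo_subset_Ioc_self hr'
    have h1 : r ^ (N - 1) * u' r = -P r := hu.2.2.1 r hr''
    have h2 : r ^ (N - 1) * v' r = -Q r := hv.2.2.1 r hr''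
    have hder : HasDerivAt W (r ^ (N - 1) * (a r - b r) * (u r * v r)) r := by
      refine (((hP (Ioo_subset_Icc_self hr')).mul (hv.2.1 r hr'')).sub
        ((hQ (Ioo_subset_Icc_self hr')).mul (hu.2.1 r hr''))).congr_deriv ?_
      linear_combination v' r * h1 - u' r * h2
    rw [hder.deriv]
    exact mul_nonneg (mul_nonneg (pow_nonneg hr'.1.le _) (sub_nonneg.mpr (hab hr')))
      (mul_nonneg (hu0 r hr) (hv0 r hr))
  rw [hW.integral_deriv_eq_sub, hWeq β ⟨hαβ, le_rfl⟩, hWeq α ⟨le_rfl, hαβ⟩] at hint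
  exact sub_nonneg.mp hint

lemma not_pos_of_pos (hu : IsRadialNeumannSolutionDeriv N a u u')
    (hv : IsRadialNeumannSolutionDeriv N b v v')
    (ha : IntervalIntegrable (fun r => r ^ (N - 1) * a r) volume 0 1)
    (hb : IntervalIntegrable (fun r => r ^ (N - 1) * b r) volume 0 1)
    (hba : ∀ᵐ r ∂(volume.restrict (Ioo (0:ℝ) 1)), b r ≤ a r)
    (hα : 0 < α) (hαβ : α < β) (hβ : β ≤ 1)
    (hvα : v α = 0) (hv'α : v' α ≠ 0) (hvβ : β = 1 ∨ v β = 0)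
    (hv0 : ∀ r ∈ Ioo α β, 0 < v r) : ¬ ∀ r ∈ Ico α β, 0 < u r := by
  intro hu0
  have hle := hu.wronskian_le hv ha hb hba hα hαβ.le hβ
    (fun r hr => (hu0 r (Ioo_subset_Ico_self hr)).le) (fun r hr => (hv0 r hr).le)
  have hαm : α ∈ Ioc (0:ℝ) 1 := ⟨hα, hαβ.le.trans hβ⟩
  have hβm : β ∈ Ioc (0:ℝ) 1 := ⟨hα.trans hαβ, hβ⟩
  have hv'α0 : 0 < v' α := by
    refine lt_of_le_of_ne ?_ hv'α.symm
    refine ge_of_tendsto (((hasDerivAt_iff_tendsto_slope.mp (hv.2.1 α hαm))).mono_left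
      (nhdsGT_le_nhdsNE α)) ?_
    filter_upwards [Ioo_mem_nhdsGT hαβ] with r hr
    rw [slope_def_field, hvα, sub_zero]
    exact div_nonneg (hv0 r hr).le (sub_nonneg.mpr hr.1.le)
  have huα := hu0 α ⟨le_rfl, hαβ⟩
  have hleft : 0 < α ^ (N - 1) * (v' α * u α - u' α * v α) := by
    rw [hvα, mul_zero, sub_zero]
    exact mul_pos (pow_pos hα _) (mul_pos hv'α0 huα)
  have hright : β ^ (N - 1) * (v' β * u β - u' β * v β) ≤ 0 := by
    rcases hvβ with rfl | hvβ
    · simp [hu.2.2.2, hv.2.2.2]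
    · have hv'β : v' β ≤ 0 := by
        refine le_of_tendsto (((hasDerivAt_iff_tendsto_slope.mp (hv.2.1 β hβm))).mono_left
          (nhdsLT_le_nhdsNE β)) ?_
        filter_upwards [Ioo_mem_nhdsLT hαβ] with r hr
        rw [slope_def_field, hvβ, sub_zero]
        exact div_nonpos_of_nonneg_of_nonpos (hv0 r hr).le (sub_nonpos.mpr hr.2.le)
      have huβ : 0 ≤ u β := by
        refine ge_of_tendsto ((hu.2.1 β hβm).continuousAt.tendsto.mono_left
          (nhdsWithin_le_nhds (s := Iio β))) ?_
        filter_upwards [Ioo_mem_nhdsLT hαβ] with r hr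
        exact (hu0 r (Ioo_subset_Ico_self hr)).le
      rw [hvβ, mul_zero, sub_zero]
      exact mul_nonpos_of_nonneg_of_nonpos (pow_nonneg hβm.1.le _)
        (mul_nonpos_of_nonpos_of_nonneg hv'β huβ)
  linarith

end IsRadialNeumannSolutionDeriv

lemma forall_pos_or_forall_neg {s : Set ℝ} {f : ℝ → ℝ} (hs : s.OrdConnected)
    (hf : ContinuousOn f s) (h0 : ∀ x ∈ s, f x ≠ 0) :
    (∀ x ∈ s, 0 < f x) ∨ (∀ x ∈ s, 0 < -f x) := by
  by_contra! h
  obtain ⟨⟨x, hx, hfx⟩, y, hy, hfy⟩ := h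
  obtain ⟨z, hz, hfz⟩ := hs.isPreconnected.intermediate_value hx hy hf
    ⟨hfx, neg_nonpos.mp hfy⟩
  exact h0 z hz hfz

namespace IsRadialNeumannSolutionDeriv

variable {N : ℕ} {a b u u' v v' : ℝ → ℝ} {α β : ℝ}

/-- Sturm comparison between a simple zero of `v` and either the next zero or the boundary. -/
lemma exists_zero_Ico (hu : IsRadialNeumannSolutionDeriv N a u u')
    (hv : IsRadialNeumannSolutionDeriv N b v v')
    (ha : IntervalIntegrable (fun r => r ^ (N - 1) * a r) volume 0 1)
    (hb : IntervalIntegrable (fun r => r ^ (N - 1) * b r) volume 0 1)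
    (hba : ∀ᵐ r ∂(volume.restrict (Ioo (0:ℝ) 1)), b r ≤ a r)
    (hα : 0 < α) (hαβ : α < β) (hβ : β ≤ 1)
    (hvα : v α = 0) (hv'α : v' α ≠ 0) (hvβ : β = 1 ∨ v β = 0)
    (hv0 : ∀ r ∈ Ioo α β, v r ≠ 0) : ∃ r ∈ Ico α β, u r = 0 := by
  by_contra! hu0
  have hsub : Ico α β ⊆ Icc 0 1 := fun r hr => ⟨hα.le.trans hr.1, hr.2.le.trans hβ⟩
  have hvn : -v α = 0 := by simp [hvα]
  have hvβn : β = 1 ∨ -v β = 0 := by simpa using hvβ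
  rcases forall_pos_or_forall_neg ordConnected_Ico (hu.1.mono hsub) hu0 with hup | hun <;>
  rcases forall_pos_or_forall_neg ordConnected_Ioo
    (hv.1.mono (Ioo_subset_Ico_self.trans hsub)) hv0 with hvp | hvm
  · exact hu.not_pos_of_pos hv ha hb hba hα hαβ hβ hvα hv'α hvβ hvp hup
  · exact hu.not_pos_of_pos hv.neg ha hb hba hα hαβ hβ hvn (neg_ne_zero.mpr hv'α) hvβn hvm hup
  · exact hu.neg.not_pos_of_pos hv ha hb hba hα hαβ hβ hvα hv'α hvβ hvp hun
  · exact hu.neg.not_pos_of_pos hv.neg ha hb hba hα hαβ hβ hvn (neg_ne_zero.mpr hv'α) hvβn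
      hvm hun

end IsRadialNeumannSolutionDeriv

/-- Between consecutive zeros of the eigenfunction, or between its largest zero and `1`, every
radial Neumann solution for a potential in `Γ_k` vanishes. -/
lemma IsRadialNeumannEigenpair.exists_zero {N k : ℕ} {μ : ℝ} {φ : ℝ → ℝ} {rz : ℕ → ℝ}
    (hek : IsRadialNeumannEigenpair N k μ φ rz) {a u : ℝ → ℝ} (ha : GammaSet N μ a)
    (hu : IsRadialNeumannSolution N a u) {i : ℕ} (hi : 1 ≤ i) (hik : i ≤ k) :
    ∃ x, rz i ≤ x ∧ x < 1 ∧ (∀ j, 1 ≤ j → j < i → x < rz j) ∧ u x = 0 := by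
  obtain ⟨-, ⟨φ', hφ⟩, -, hmem, hanti, hzero, hsimple⟩ := hek
  obtain ⟨u', hu⟩ := hu
  have hle : ∀ {j l : ℕ}, 1 ≤ j → j ≤ l → l ≤ k → rz l ≤ rz j := fun hj hjl hl =>
    hjl.eq_or_lt.elim (fun h => h ▸ le_rfl) fun h => (hanti _ _ hj h hl).le
  have hconst : IntervalIntegrable (fun r : ℝ => r ^ (N - 1) * μ) volume 0 1 :=
    Continuous.intervalIntegrable (by fun_prop) _ _
  have hφi : φ (rz i) = 0 := (hzero _ (hmem i hi hik)).mpr ⟨i, hi, hik, rfl⟩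
  have hφ'i : φ' (rz i) ≠ 0 := by
    obtain ⟨d, hd, hder⟩ := hsimple i hi hik
    rwa [(hφ.2.1 _ (Ioo_subset_Ioc_self (hmem i hi hik))).unique hder]
  obtain ⟨β, hαβ, hβ, hβlt, hvβ, hne⟩ : ∃ β, rz i < β ∧ β ≤ 1 ∧
      (∀ j, 1 ≤ j → j < i → β ≤ rz j) ∧ (β = 1 ∨ φ β = 0) ∧
      ∀ j, 1 ≤ j → j ≤ k → rz j ∉ Ioo (rz i) β := by
    rcases hi.eq_or_lt with rfl | hi1
    · refine ⟨1, (hmem 1 hi hik).2, le_rfl, fun j _ _ => by omega, .inl rfl, ?_⟩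
      exact fun j hj hjk hm => absurd hm.1 (hle le_rfl hj hjk).not_gt
    · have him : 1 ≤ i - 1 := by omega
      have himk : i - 1 ≤ k := by omega
      refine ⟨rz (i - 1), hanti _ _ him (by omega) hik, (hmem _ him himk).2.le,
        fun j hj hji => hle hj (by omega) himk,
        .inr ((hzero _ (hmem _ him himk)).mpr ⟨i - 1, him, himk, rfl⟩), fun j hj hjk hm => ?_⟩
      rcases lt_or_ge j i with hji | hji
      · exact absurd hm.2 (hle hj (by omega) himk).not_gt
      · exact absurd hm.1 (hle hi hji hjk).not_gt
  obtain ⟨x, hx, hux⟩ := hu.exists_zero_Ico hφ ha.intervalIntegrable hconst ha.2.1.1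
    (hmem i hi hik).1 hαβ hβ hφi hφ'i hvβ fun r hr h0 => by
      obtain ⟨j, hj, hjk, rfl⟩ :=
        (hzero r ⟨(hmem i hi hik).1.trans hr.1, hr.2.trans_le hβ⟩).mp h0
      exact hne j hj hjk hr
  exact ⟨x, hx.1, hx.2.trans_le hβ, fun j hj hji => hx.2.trans_le (hβlt j hj hji), hux⟩

/-- For `k ≥ 1`, `a ∈ Γ_k`, and `u` a nontrivial radial Neumann solution of
`Δu + a u = 0`: for every `1 ≤ i ≤ k`, `u` has at least `i` zeros in `[r_i, 1)`;
consequently, if `u` has finitely many zeros in `(0,1)` and `x_k < ⋯ < x_1` are its `k`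
largest zeros, then `r_i ≤ x_i` for every `1 ≤ i ≤ k`. -/
theorem stmt4 (N k : ℕ) (hN : 2 ≤ N) (hk1 : 1 ≤ k) (μk : ℝ) (φk : ℝ → ℝ) (rz : ℕ → ℝ)
    (hek : IsRadialNeumannEigenpair N k μk φk rz)
    (a : ℝ → ℝ) (ha : GammaSet N μk a)
    (u : ℝ → ℝ) (hu : IsRadialNeumannSolution N a u) (hunt : NontrivialSol u) :
    (∀ i, 1 ≤ i → i ≤ k →
      ∃ Z : Finset ℝ, ↑Z ⊆ Ico (rz i) 1 ∧ i ≤ Z.card ∧ ∀ x ∈ Z, u x = 0) ∧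
    (∀ xz : ℕ → ℝ,
      {x ∈ Ioo (0:ℝ) 1 | u x = 0}.Finite →
      (∀ i, 1 ≤ i → i ≤ k → xz i ∈ Ioo (0:ℝ) 1 ∧ u (xz i) = 0) →
      (∀ i j, 1 ≤ i → i < j → j ≤ k → xz j < xz i) →
      (∀ z ∈ Ioo (0:ℝ) 1, u z = 0 → (∃ i, 1 ≤ i ∧ i ≤ k ∧ z = xz i) ∨ z < xz k) →
      ∀ i, 1 ≤ i → i ≤ k → rz i ≤ xz i) := by
  have hzeros : ∀ i, 1 ≤ i → i ≤ k →
      ∃ Z : Finset ℝ, ↑Z ⊆ Ico (rz i) 1 ∧ i ≤ Z.card ∧ ∀ x ∈ Z, u x = 0 := by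
    intro i
    induction i with
    | zero => intro h; omega
    | succ i ih =>
      intro _ hik
      obtain ⟨x, hx, hx1, hxlt, hux⟩ := hek.exists_zero ha hu (Nat.succ_pos i) hik
      rcases i.eq_zero_or_pos with rfl | hi
      · exact ⟨{x}, by simpa using ⟨hx, hx1⟩, by simp, by simpa using hux⟩
      obtain ⟨Z, hZ, hcard, hZ0⟩ := ih hi (by omega)
      have hxi := hxlt i hi (Nat.lt_succ_self i)
      have hxZ : x ∉ Z := fun h => absurd (hZ h).1 hxi.not_ge
      refine ⟨insert x Z, ?_, by rw [Finset.card_insert_of_notMem hxZ]; omega, ?_⟩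
      · rw [Finset.coe_insert, insert_subset_iff]
        exact ⟨⟨hx, hx1⟩, fun z hz => ⟨(hx.trans hxi.le).trans (hZ hz).1, (hZ hz).2⟩⟩
      · simpa using ⟨hux, hZ0⟩
  refine ⟨hzeros, fun xz _ _ hanti hall i hi hik => ?_⟩
  by_contra! hlt
  obtain ⟨Z, hZ, hcard, hZ0⟩ := hzeros i hi hik
  have hle : ∀ {j l : ℕ}, 1 ≤ j → j ≤ l → l ≤ k → xz l ≤ xz j := fun hj hjl hl =>
    hjl.eq_or_lt.elim (fun h => h ▸ le_rfl) fun h => (hanti _ _ hj h hl).le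
  have hsub : Z ⊆ (Finset.Ico 1 i).image xz := fun z hz => by
    have hxz : xz i < z := hlt.trans_le (hZ hz).1
    have hri := (hek.2.2.2.1 i hi hik).1
    rcases hall z ⟨hri.trans_le (hZ hz).1, (hZ hz).2⟩ (hZ0 z hz) with ⟨j, hj, hjk, rfl⟩ | h
    · refine Finset.mem_image_of_mem _ (Finset.mem_Ico.mpr ⟨hj, ?_⟩)
      by_contra! hij
      exact absurd hxz (hle hi hij hjk).not_gt
    · exact absurd (hxz.trans h) (hle hi hik le_rfl).not_gt
  have := (Finset.card_le_card hsub).trans Finset.card_image_le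
  rw [Nat.card_Ico] at this
  omega
end
end

section
/- Let N ≥ 2 and R > 0. For each ε ∈ (0,R), let λ(ε) ∈ ℝ be such that there exists a continuous function u_ε : [ε,R] → ℝ, differentiable on (ε,R), with u_ε > 0 on (ε,R), u_ε(ε) = u_ε(R) = 0, and r^{N−1}u_ε′(r) − s^{N−1}u_ε′(s) = −λ(ε) ∫_s^r t^{N−1} u_ε(t) dt for all ε < s < r < R (so λ(ε) is the first Dirichlet eigenvalue λ_1(A(ε,R)) of −Δ on the annulus A(ε,R)). Let λ* ∈ ℝ be such that there exists a continuous u : [0,R] → ℝ, differentiable on (0,R], with u > 0 on [0,R), u(R) = 0, and r^{N−1}u′(r) = −λ* ∫_0^r t^{N−1} u(t) dt for all r ∈ (0,R] (so λ* is the first Dirichlet eigenvalue λ_1(B_R) of −Δ on the ball B_R). Then λ(ε) → λ* as ε → 0⁺. -/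
open MeasureTheory Set Filter

noncomputable section

/-- `u` solves `(r^(N-1) u')' = q` on `(a, b)`, in first-order form with flux `U = r^(N-1) u'`,
where `u` and `U` are continuous up to the boundary. -/
structure IsRadialFluxSolution (N : ℕ) (a b : ℝ) (u U q : ℝ → ℝ) : Prop where
  cont : ContinuousOn u (Icc a b)
  contFlux : ContinuousOn U (Icc a b)
  deriv : ∀ r ∈ Ioo a b, HasDerivAt u (U r / r ^ (N - 1)) r
  derivFlux : ∀ r ∈ Ioo a b, HasDerivAt U (q r) r

lemma IsRadialFluxSolution.mono {N : ℕ} {a a' b : ℝ} {u U q : ℝ → ℝ}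
    (h : IsRadialFluxSolution N a b u U q) (ha : a ≤ a') :
    IsRadialFluxSolution N a' b u U q :=
  ⟨h.cont.mono (Icc_subset_Icc_left ha), h.contFlux.mono (Icc_subset_Icc_left ha),
    fun r hr => h.deriv r (Ioo_subset_Ioo_left ha hr),
    fun r hr => h.derivFlux r (Ioo_subset_Ioo_left ha hr)⟩

lemma IsRadialFluxSolution.neg {N : ℕ} {a b : ℝ} {u U q : ℝ → ℝ}
    (h : IsRadialFluxSolution N a b u U q) :
    IsRadialFluxSolution N a b (fun r => -u r) (fun r => -U r) (fun r => -q r) :=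
  ⟨h.cont.neg, h.contFlux.neg, fun r hr => by simpa [neg_div] using (h.deriv r hr).fun_neg,
    fun r hr => (h.derivFlux r hr).fun_neg⟩

lemma continuousOn_primitive_Icc {f : ℝ → ℝ} {a b c : ℝ}
    (hf : ContinuousOn f (Icc a b)) (hc : c ∈ Icc a b) :
    ContinuousOn (fun r => ∫ t in c..r, f t) (Icc a b) := by
  have hab : a ≤ b := hc.1.trans hc.2
  rw [← uIcc_of_le hab] at hf hc ⊢
  exact intervalIntegral.continuousOn_primitive_interval'
    hf.intervalIntegrable hc

lemma hasDerivAt_primitive_of_mem_Ioo {f : ℝ → ℝ} {a b c r : ℝ}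
    (hf : ContinuousOn f (Icc a b)) (hc : c ∈ Icc a b) (hr : r ∈ Ioo a b) :
    HasDerivAt (fun r => ∫ t in c..r, f t) (f r) r := by
  refine intervalIntegral.integral_hasDerivAt_right
    (hf.mono (uIcc_subset_Icc hc (Ioo_subset_Icc_self hr))).intervalIntegrable ?_
    (hf.continuousAt (Icc_mem_nhds hr.1 hr.2))
  exact (hf.mono Ioo_subset_Icc_self).stronglyMeasurableAtFilter isOpen_Ioo r hr

lemma isRadialFluxSolution_primitive {N : ℕ} {a b c κ lam : ℝ} {u u' : ℝ → ℝ}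
    (ha : 0 ≤ a) (hu : ContinuousOn u (Icc a b)) (hc : c ∈ Icc a b)
    (hd : ∀ r ∈ Ioo a b, HasDerivAt u (u' r) r)
    (hflux : ∀ r ∈ Ioo a b, r ^ (N - 1) * u' r = κ - lam * ∫ t in c..r, t ^ (N - 1) * u t) :
    IsRadialFluxSolution N a b u (fun r => κ - lam * ∫ t in c..r, t ^ (N - 1) * u t)
      (fun r => -lam * (r ^ (N - 1) * u r)) := by
  have hf : ContinuousOn (fun t => t ^ (N - 1) * u t) (Icc a b) :=
    (continuous_pow _).continuousOn.mul hu
  refine ⟨hu, continuousOn_const.sub (continuousOn_const.mul (continuousOn_primitive_Icc hf hc)),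
    fun r hr => ?_, fun r hr => ?_⟩
  · have hp : r ^ (N - 1) ≠ 0 := pow_ne_zero _ (ha.trans_lt hr.1).ne'
    rw [← hflux r hr, mul_div_cancel_left₀ _ hp]
    exact hd r hr
  · simpa using ((hasDerivAt_primitive_of_mem_Ioo hf hc hr).const_mul lam).const_sub κ

lemma flux_left_nonneg {N : ℕ} {a b : ℝ} {u U q : ℝ → ℝ} (ha : 0 ≤ a) (hab : a < b)
    (h : IsRadialFluxSolution N a b u U q) (hpos : ∀ r ∈ Ioo a b, 0 < u r) (hua : u a = 0) :
    0 ≤ U a := by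
  by_contra! hneg
  have hev : ∀ᶠ r in nhdsWithin a (Icc a b), U r < 0 :=
    (h.contFlux a (left_mem_Icc.2 hab.le)).eventually (gt_mem_nhds hneg)
  rw [nhdsWithin_Icc_eq_nhdsGE hab] at hev
  obtain ⟨d, hd, hsub⟩ := (mem_nhdsGE_iff_exists_mem_Ioc_Ico_subset hab).1 hev
  obtain ⟨e, hae, hed⟩ := exists_between hd.1
  have heb : e < b := hed.trans_le hd.2
  obtain ⟨c, hc, hce⟩ := exists_hasDerivAt_eq_slope u _ hae
    (h.cont.mono (Icc_subset_Icc_right heb.le))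
    (fun r hr => h.deriv r ⟨hr.1, hr.2.trans heb⟩)
  have h1 : U c / c ^ (N - 1) < 0 :=
    div_neg_of_neg_of_pos (hsub ⟨hc.1.le, hc.2.trans hed⟩) (pow_pos (ha.trans_lt hc.1) _)
  have h2 : 0 < (u e - u a) / (e - a) := by
    rw [hua, sub_zero]
    exact div_pos (hpos e ⟨hae, heb⟩) (sub_pos.2 hae)
  linarith

lemma flux_right_nonpos {N : ℕ} {a b : ℝ} {u U q : ℝ → ℝ} (ha : 0 ≤ a) (hab : a < b)
    (h : IsRadialFluxSolution N a b u U q) (hpos : ∀ r ∈ Ioo a b, 0 < u r) (hub : u b = 0) :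
    U b ≤ 0 := by
  by_contra! hneg
  have hev : ∀ᶠ r in nhdsWithin b (Icc a b), 0 < U r :=
    (h.contFlux b (right_mem_Icc.2 hab.le)).eventually (lt_mem_nhds hneg)
  rw [nhdsWithin_Icc_eq_nhdsLE hab] at hev
  obtain ⟨d, hd, hsub⟩ := (mem_nhdsLE_iff_exists_mem_Ico_Ioc_subset hab).1 hev
  obtain ⟨e, hde, heb⟩ := exists_between hd.2
  have hae : a < e := hd.1.trans_lt hde
  obtain ⟨c, hc, hce⟩ := exists_hasDerivAt_eq_slope u _ heb
    (h.cont.mono (Icc_subset_Icc_left hae.le))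
    (fun r hr => h.deriv r ⟨hae.trans hr.1, hr.2⟩)
  have h1 : 0 < U c / c ^ (N - 1) :=
    div_pos (hsub ⟨hde.trans hc.1, hc.2.le⟩) (pow_pos (ha.trans_lt (hae.trans hc.1)) _)
  have h2 : (u b - u e) / (b - e) < 0 := by
    rw [hub, zero_sub]
    exact div_neg_of_neg_of_pos (neg_lt_zero.2 (hpos e ⟨hae, heb⟩)) (sub_pos.2 heb)
  linarith

/-- Comparison principle: testing against a positive Dirichlet eigenfunction, a function which is
nonpositive on the boundary cannot be a strict subsolution. -/
lemma exists_nonpos_of_boundary_nonpos {N : ℕ} {a b lam : ℝ} {u U w W q : ℝ → ℝ}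
    (ha : 0 ≤ a) (hab : a < b)
    (hu : IsRadialFluxSolution N a b u U (fun r => -lam * (r ^ (N - 1) * u r)))
    (hpos : ∀ r ∈ Ioo a b, 0 < u r) (hua : u a = 0) (hub : u b = 0)
    (hw : IsRadialFluxSolution N a b w W q) (hwa : w a ≤ 0) (hwb : w b ≤ 0) :
    ∃ c ∈ Ioo a b, q c + lam * (c ^ (N - 1) * w c) ≤ 0 := by
  obtain ⟨c, hc, hce⟩ := exists_hasDerivAt_eq_slope (fun r => U r * w r - u r * W r) _ hab
    ((hu.contFlux.mul hw.cont).sub (hu.cont.mul hw.contFlux))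
    (fun r hr => ((hu.derivFlux r hr).mul (hw.deriv r hr)).sub
      ((hu.deriv r hr).mul (hw.derivFlux r hr)))
  refine ⟨c, hc, ?_⟩
  have hslope : 0 ≤ (U b * w b - u b * W b - (U a * w a - u a * W a)) / (b - a) := by
    rw [hua, hub]
    have h1 := mul_nonneg_of_nonpos_of_nonpos (flux_right_nonpos ha hab hu hpos hub) hwb
    have h2 := mul_nonpos_of_nonneg_of_nonpos (flux_left_nonneg ha hab hu hpos hua) hwa
    exact div_nonneg (by linarith) (sub_pos.2 hab).le
  rw [← hce] at hslope
  have huc := hpos c hc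
  refine nonpos_of_mul_nonpos_right (a := u c) ?_ huc
  linear_combination hslope

lemma exists_nonneg_of_boundary_nonneg {N : ℕ} {a b lam : ℝ} {u U w W q : ℝ → ℝ}
    (ha : 0 ≤ a) (hab : a < b)
    (hu : IsRadialFluxSolution N a b u U (fun r => -lam * (r ^ (N - 1) * u r)))
    (hpos : ∀ r ∈ Ioo a b, 0 < u r) (hua : u a = 0) (hub : u b = 0)
    (hw : IsRadialFluxSolution N a b w W q) (hwa : 0 ≤ w a) (hwb : 0 ≤ w b) :
    ∃ c ∈ Ioo a b, 0 ≤ q c + lam * (c ^ (N - 1) * w c) := by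
  obtain ⟨c, hc, h⟩ := exists_nonpos_of_boundary_nonpos ha hab hu hpos hua hub hw.neg
    (neg_nonpos.2 hwa) (neg_nonpos.2 hwb)
  exact ⟨c, hc, by linear_combination h⟩

/-- A Dirichlet eigenvalue with positive eigenfunction dominates the eigenvalue of any solution
which is positive inside and nonnegative on the boundary. -/
lemma eigenvalue_le_of_pos {N : ℕ} {a b lam mu : ℝ} {u U v V : ℝ → ℝ}
    (ha : 0 ≤ a) (hab : a < b)
    (hu : IsRadialFluxSolution N a b u U (fun r => -lam * (r ^ (N - 1) * u r)))
    (hpos : ∀ r ∈ Ioo a b, 0 < u r) (hua : u a = 0) (hub : u b = 0)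
    (hv : IsRadialFluxSolution N a b v V (fun r => -mu * (r ^ (N - 1) * v r)))
    (hvpos : ∀ r ∈ Ico a b, 0 < v r) (hvb : v b = 0) : mu ≤ lam := by
  obtain ⟨c, hc, h⟩ := exists_nonneg_of_boundary_nonneg ha hab hu hpos hua hub hv
    (hvpos a (left_mem_Ico.2 hab)).le hvb.ge
  have hp : 0 < c ^ (N - 1) * v c :=
    mul_pos (pow_pos (ha.trans_lt hc.1) _) (hvpos c (Ioo_subset_Ico_self hc))
  nlinarith

/-- The function `1 + log (R / r)`; its logarithm is a singular superharmonic function on the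
punctured ball in every dimension `N ≥ 2`. -/
def oneAddLog (R r : ℝ) : ℝ := 1 + (Real.log R - Real.log r)

lemma one_le_oneAddLog {R r : ℝ} (hr : 0 < r) (hrR : r ≤ R) : 1 ≤ oneAddLog R r := by
  have := Real.log_le_log hr hrR
  unfold oneAddLog
  linarith

lemma hasDerivAt_oneAddLog {R r : ℝ} (hr : 0 < r) :
    HasDerivAt (oneAddLog R) (-r⁻¹) r :=
  ((Real.hasDerivAt_log hr.ne').const_sub _).const_add _

lemma continuousOn_oneAddLog {R : ℝ} : ContinuousOn (oneAddLog R) (Ioi 0) :=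
  fun _ hr => (hasDerivAt_oneAddLog hr).continuousAt.continuousWithinAt

lemma tendsto_oneAddLog_atTop (R : ℝ) :
    Tendsto (oneAddLog R) (nhdsWithin 0 (Ioi 0)) atTop :=
  tendsto_atTop_add_const_left _ _ (tendsto_atTop_add_const_left _ _
    (tendsto_neg_atBot_atTop.comp Real.tendsto_log_nhdsGT_zero))

lemma isRadialFluxSolution_logLog {N : ℕ} (hN : 2 ≤ N) {a R : ℝ} (ha : 0 < a) :
    IsRadialFluxSolution N a R (fun r => Real.log (oneAddLog R r))
      (fun r => -(r ^ (N - 2) / oneAddLog R r))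
      (fun r => -(((N - 2 : ℕ) * r ^ (N - 2 - 1) * oneAddLog R r - r ^ (N - 2) * (-r⁻¹))
        / oneAddLog R r ^ 2)) := by
  have hc : ContinuousOn (oneAddLog R) (Icc a R) :=
    continuousOn_oneAddLog.mono fun r hr => ha.trans_le hr.1
  have hpos : ∀ r ∈ Icc a R, oneAddLog R r ≠ 0 := fun r hr =>
    (zero_lt_one.trans_le (one_le_oneAddLog (ha.trans_le hr.1) hr.2)).ne'
  refine ⟨hc.log hpos, ((continuous_pow _).continuousOn.div hc hpos).neg, fun r hr => ?_,
    fun r hr => ?_⟩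
  · have hr0 : 0 < r := ha.trans hr.1
    convert (hasDerivAt_oneAddLog hr0).log (hpos r (Ioo_subset_Icc_self hr)) using 1
    have hL := hpos r (Ioo_subset_Icc_self hr)
    rw [show N - 1 = N - 2 + 1 by omega, pow_succ]
    field_simp
  · exact ((hasDerivAt_pow _ r).div (hasDerivAt_oneAddLog (ha.trans hr.1))
      (hpos r (Ioo_subset_Icc_self hr))).neg

lemma tendsto_sq_mul_oneAddLog_cube (R : ℝ) :
    Tendsto (fun r => r ^ 2 * oneAddLog R r ^ 3) (nhdsWithin 0 (Ioi 0)) (nhds 0) := by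
  have h1 := tendsto_log_mul_rpow_nhdsGT_zero (r := 2 / 3) (by norm_num)
  have h2 : Tendsto (fun r : ℝ => r ^ (2 / 3 : ℝ)) (nhdsWithin 0 (Ioi 0)) (nhds 0) := by
    have := (Real.continuousAt_rpow_const 0 (2 / 3 : ℝ) (Or.inr (by norm_num))).tendsto
    rw [Real.zero_rpow (by norm_num)] at this
    exact this.mono_left nhdsWithin_le_nhds
  have h3 := ((h2.const_mul (1 + Real.log R)).sub h1).pow 3
  simp only [mul_zero, sub_zero, ne_eq, OfNat.ofNat_ne_zero, not_false_eq_true, zero_pow] at h3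
  refine h3.congr' ?_
  filter_upwards [self_mem_nhdsWithin] with r hr
  have h4 : (r ^ (2 / 3 : ℝ)) ^ 3 = r ^ 2 := by
    rw [← Real.rpow_natCast, ← Real.rpow_mul (le_of_lt hr)]
    norm_num
  rw [← h4, oneAddLog]
  ring

/-- The defect of `log (oneAddLog R)` as a supersolution is negative near `0` and near `R`, hence
controlled by any function which is positive inside. -/
lemma exists_logLog_defect_le {R Λ : ℝ} (hR : 0 < R) (hΛ : 0 < Λ) {v : ℝ → ℝ}
    (hv : ContinuousOn v (Icc 0 R)) (hpos : ∀ r ∈ Ico 0 R, 0 < v r) :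
    ∃ C : ℝ, ∀ r ∈ Ioo 0 R,
      Λ * Real.log (oneAddLog R r) - (r ^ 2 * oneAddLog R r ^ 2)⁻¹ ≤ C * v r := by
  set K : ℝ → ℝ := fun r => Λ * Real.log (oneAddLog R r) - (r ^ 2 * oneAddLog R r ^ 2)⁻¹ with hK
  have hLpos : ∀ r ∈ Ioc 0 R, 0 < oneAddLog R r := fun r hr =>
    zero_lt_one.trans_le (one_le_oneAddLog hr.1 hr.2)
  have hKc : ContinuousOn K (Ioc 0 R) := by
    have hc : ContinuousOn (oneAddLog R) (Ioc 0 R) :=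
      continuousOn_oneAddLog.mono fun r hr => hr.1
    refine (continuousOn_const.mul (hc.log fun r hr => (hLpos r hr).ne')).sub
      (((continuous_pow 2).continuousOn.mul (hc.pow 2)).inv₀ fun r hr => ?_)
    exact mul_ne_zero (pow_ne_zero 2 hr.1.ne') (pow_ne_zero 2 (hLpos r hr).ne')
  have hzero : ∀ᶠ r in nhdsWithin 0 (Ioi 0), K r ≤ 0 := by
    filter_upwards [(tendsto_sq_mul_oneAddLog_cube R).eventually
      (gt_mem_nhds (inv_pos.2 hΛ)), Ioo_mem_nhdsGT hR] with r hr hrR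
    have hr0 := hrR.1
    have hL := hLpos r (Ioo_subset_Ioc_self hrR)
    have hlog : Real.log (oneAddLog R r) ≤ oneAddLog R r :=
      (Real.log_le_sub_one_of_pos hL).trans (by linarith)
    rw [hK]
    refine sub_nonpos.2 ((mul_le_mul_of_nonneg_left hlog hΛ.le).trans ?_)
    rw [← one_div, le_div_iff₀ (by positivity)]
    have := mul_lt_mul_of_pos_left hr hΛ
    rw [mul_inv_cancel₀ hΛ.ne'] at this
    linear_combination this
  have hend : ∀ᶠ r in nhdsWithin R (Iio R), K r ≤ 0 := by
    have hKR : K R < 0 := by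
      simp only [hK, oneAddLog, sub_self, add_zero, Real.log_one, mul_zero, one_pow, mul_one,
        zero_sub, neg_lt_zero]
      positivity
    have := (hKc R (right_mem_Ioc.2 hR)).eventually (gt_mem_nhds hKR)
    rw [nhdsWithin_Ioc_eq_nhdsLE hR] at this
    exact (this.filter_mono (nhdsWithin_mono _ Iio_subset_Iic_self)).mono fun _ => le_of_lt
  obtain ⟨d, hd, hdK⟩ := (mem_nhdsGT_iff_exists_Ioo_subset).1 hzero
  obtain ⟨e, he, heK⟩ := (mem_nhdsLT_iff_exists_Ioo_subset).1 hend
  have hd : 0 < d := hd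
  have he : e < R := he
  have hsub : Icc d e ⊆ Ioo 0 R := fun r hr => ⟨hd.trans_le hr.1, hr.2.trans_lt he⟩
  have hquot : ContinuousOn (fun r => K r / v r) (Icc d e) :=
    (hKc.mono (hsub.trans Ioo_subset_Ioc_self)).div
      (hv.mono (hsub.trans Ioo_subset_Icc_self))
      fun r hr => (hpos r (Ioo_subset_Ico_self (hsub hr))).ne'
  obtain ⟨C, hC⟩ := isCompact_Icc.bddAbove_image hquot
  refine ⟨max C 0, fun r hr => ?_⟩
  have hvr := hpos r (Ioo_subset_Ico_self hr)
  have hnn : 0 ≤ max C 0 * v r := mul_nonneg (le_max_right _ _) hvr.le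
  rcases lt_or_ge r d with h | h
  · exact (hdK ⟨hr.1, h⟩ : K r ≤ 0).trans hnn
  rcases lt_or_ge e r with h' | h'
  · exact (heK ⟨h', hr.2⟩ : K r ≤ 0).trans hnn
  · exact (div_le_iff₀ hvr).1 ((hC (mem_image_of_mem _ ⟨h, h'⟩)).trans (le_max_left _ _))

lemma IsRadialFluxSolution.sub_const_mul {N : ℕ} {a b k : ℝ} {v V p g G q : ℝ → ℝ}
    (hv : IsRadialFluxSolution N a b v V p) (hg : IsRadialFluxSolution N a b g G q) :
    IsRadialFluxSolution N a b (fun r => v r - k * g r) (fun r => V r - k * G r)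
      (fun r => p r - k * q r) := by
  refine ⟨hv.cont.sub (continuousOn_const.mul hg.cont),
    hv.contFlux.sub (continuousOn_const.mul hg.contFlux), fun r hr => ?_,
    fun r hr => (hv.derivFlux r hr).sub ((hg.derivFlux r hr).const_mul k)⟩
  exact ((hv.deriv r hr).sub ((hg.deriv r hr).const_mul k)).congr_deriv (by ring)

/-- Quantitative upper bound for the annulus eigenvalue, by comparing with the ball eigenfunction
minus a multiple of the singular function `log (oneAddLog R)`. -/
lemma eigenvalue_le_add_div {N : ℕ} (hN : 2 ≤ N) {a R lam mu Λ C : ℝ} {u U v V : ℝ → ℝ}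
    (ha : 0 < a) (haR : a < R)
    (hu : IsRadialFluxSolution N a R u U (fun r => -lam * (r ^ (N - 1) * u r)))
    (hpos : ∀ r ∈ Ioo a R, 0 < u r) (hua : u a = 0) (hub : u R = 0)
    (hv : IsRadialFluxSolution N a R v V (fun r => -mu * (r ^ (N - 1) * v r)))
    (hvpos : ∀ r ∈ Ico a R, 0 < v r) (hvb : v R = 0) (hlam : lam ≤ Λ)
    (hC : ∀ r ∈ Ioo a R,
      Λ * Real.log (oneAddLog R r) - (r ^ 2 * oneAddLog R r ^ 2)⁻¹ ≤ C * v r) :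
    lam ≤ mu + C * (v a / Real.log (oneAddLog R a)) := by
  have hga : 0 < Real.log (oneAddLog R a) := by
    have := Real.log_lt_log ha haR
    exact Real.log_pos (by unfold oneAddLog; linarith)
  set k := v a / Real.log (oneAddLog R a) with hk
  have hk0 : 0 ≤ k := div_nonneg (hvpos a (left_mem_Ico.2 haR)).le hga.le
  obtain ⟨c, hc, h⟩ := exists_nonpos_of_boundary_nonpos ha.le haR hu hpos hua hub
    (hv.sub_const_mul (k := k) (isRadialFluxSolution_logLog hN ha))
    (by rw [hk, div_mul_cancel₀ _ hga.ne', sub_self])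
    (by simp [hvb, oneAddLog])
  have hc0 : 0 < c := ha.trans hc.1
  have hL1 := one_le_oneAddLog hc0 hc.2.le
  have hvc := hvpos c (Ioo_subset_Ico_self hc)
  have hCc := hC c hc
  set L := oneAddLog R c
  have hL : 0 < L := zero_lt_one.trans_le hL1
  have hg : 0 ≤ Real.log L := Real.log_nonneg hL1
  have hp : 0 < c ^ (N - 1) := pow_pos hc0 _
  have hsplit : ((N - 2 : ℕ) * c ^ (N - 2 - 1) * L - c ^ (N - 2) * (-c⁻¹)) / L ^ 2
      = (N - 2 : ℕ) * c ^ (N - 2 - 1) / L + c ^ (N - 1) * (c ^ 2 * L ^ 2)⁻¹ := by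
    rw [show N - 1 = N - 2 + 1 by omega, pow_succ]
    field_simp
    ring
  have hrest : 0 ≤ (N - 2 : ℕ) * c ^ (N - 2 - 1) / L := by positivity
  rw [hsplit] at h
  set s := (c ^ 2 * L ^ 2)⁻¹
  have h1 : c ^ (N - 1) * ((lam - mu) * v c - k * (lam * Real.log L - s)) ≤ 0 := by
    nlinarith [mul_nonneg hk0 hrest]
  have h2 : (lam - mu) * v c - k * (lam * Real.log L - s) ≤ 0 :=
    nonpos_of_mul_nonpos_right h1 hp
  have h3 : k * (lam * Real.log L - s) ≤ k * (C * v c) :=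
    mul_le_mul_of_nonneg_left
      (by linarith [mul_le_mul_of_nonneg_right hlam hg]) hk0
  have h4 : (lam - mu - C * k) * v c ≤ 0 := by linear_combination h2 + h3
  linarith [nonpos_of_mul_nonpos_left h4 hvc]

/-- Continuous dependence of the first Dirichlet eigenvalue:
`λ_1(A(ε,R)) → λ_1(B_R)` as `ε → 0⁺`, where eigenvalues are characterized by the existence
of positive radial eigenfunctions vanishing on the boundary (integrated radial form). -/
theorem stmt9 (N : ℕ) (hN : 2 ≤ N) (R : ℝ) (hR : 0 < R)
    (lam : ℝ → ℝ) (lamStar : ℝ)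
    (hlam : ∀ ε ∈ Ioo (0:ℝ) R, ∃ u u' : ℝ → ℝ,
      ContinuousOn u (Icc ε R) ∧
      (∀ r ∈ Ioo ε R, HasDerivAt u (u' r) r) ∧
      (∀ r ∈ Ioo ε R, 0 < u r) ∧ u ε = 0 ∧ u R = 0 ∧
      (∀ s ∈ Ioo ε R, ∀ r ∈ Ioo ε R, s < r →
        r ^ (N - 1) * u' r - s ^ (N - 1) * u' s
          = - lam ε * ∫ t in s..r, t ^ (N - 1) * u t))
    (hstar : ∃ u u' : ℝ → ℝ,
      ContinuousOn u (Icc 0 R) ∧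
      (∀ r ∈ Ioc (0:ℝ) R, HasDerivAt u (u' r) r) ∧
      (∀ r ∈ Ico (0:ℝ) R, 0 < u r) ∧ u R = 0 ∧
      (∀ r ∈ Ioc (0:ℝ) R,
        r ^ (N - 1) * u' r = - lamStar * ∫ t in (0:ℝ)..r, t ^ (N - 1) * u t)) :
    Tendsto lam (nhdsWithin 0 (Ioi 0)) (nhds lamStar) := by
  obtain ⟨v, v', hvc, hvd, hvpos, hvR, hveq⟩ := hstar
  have hv := isRadialFluxSolution_primitive (N := N) (κ := 0) (lam := lamStar) le_rfl hvc
    (left_mem_Icc.2 hR.le) (fun r hr => hvd r (Ioo_subset_Ioc_self hr))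
    (fun r hr => by rw [hveq r (Ioo_subset_Ioc_self hr)]; ring)
  have hann : ∀ ε ∈ Ioo (0:ℝ) R, ∃ u U : ℝ → ℝ,
      IsRadialFluxSolution N ε R u U (fun r => -lam ε * (r ^ (N - 1) * u r)) ∧
      (∀ r ∈ Ioo ε R, 0 < u r) ∧ u ε = 0 ∧ u R = 0 := by
    intro ε hε
    obtain ⟨u, u', huc, hud, hupos, huε, huR, hueq⟩ := hlam ε hε
    obtain ⟨c, hc⟩ := exists_between hε.2
    refine ⟨u, _, isRadialFluxSolution_primitive (κ := c ^ (N - 1) * u' c) hε.1.le huc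
      (Ioo_subset_Icc_self hc) hud fun r hr => ?_, hupos, huε, huR⟩
    rcases lt_trichotomy c r with h | rfl | h
    · linear_combination hueq c hc r hr h
    · simp
    · rw [intervalIntegral.integral_symm]
      linear_combination -hueq r hr c hc h
  have hlower : ∀ ε ∈ Ioo (0:ℝ) R, lamStar ≤ lam ε := by
    intro ε hε
    obtain ⟨u, U, hu, hupos, huε, huR⟩ := hann ε hε
    exact eigenvalue_le_of_pos hε.1.le hε.2 hu hupos huε huR (hv.mono hε.1.le)
      (fun r hr => hvpos r ⟨hε.1.le.trans hr.1, hr.2⟩) hvR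
  obtain ⟨δ, hδ⟩ : ∃ δ, δ ∈ Ioo 0 R := exists_between hR
  have hbdd : ∀ ε ∈ Ioo 0 δ, lam ε ≤ max (lam δ) 1 := by
    intro ε hε
    obtain ⟨u, U, hu, hupos, huδ, huR⟩ := hann δ hδ
    obtain ⟨z, Z, hz, hzpos, -, hzR⟩ := hann ε ⟨hε.1, hε.2.trans hδ.2⟩
    exact (eigenvalue_le_of_pos hδ.1.le hδ.2 hu hupos huδ huR (hz.mono hε.2.le)
      (fun r hr => hzpos r ⟨hε.2.trans_le hr.1, hr.2⟩) hzR).trans (le_max_left _ _)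
  obtain ⟨C, hC⟩ := exists_logLog_defect_le hR
    (zero_lt_one.trans_le (le_max_right (lam δ) 1)) hvc hvpos
  have hupper : ∀ ε ∈ Ioo 0 δ, lam ε ≤ lamStar + C * (v ε / Real.log (oneAddLog R ε)) := by
    intro ε hε
    have hεR : ε < R := hε.2.trans hδ.2
    obtain ⟨u, U, hu, hupos, huε, huR⟩ := hann ε ⟨hε.1, hεR⟩
    exact eigenvalue_le_add_div hN hε.1 hεR hu hupos huε huR (hv.mono hε.1.le)
      (fun r hr => hvpos r ⟨hε.1.le.trans hr.1, hr.2⟩) hvR (hbdd ε hε)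
      fun r hr => hC r ⟨hε.1.trans hr.1, hr.2⟩
  have hvlim : Tendsto v (nhdsWithin 0 (Ioi 0)) (nhds (v 0)) := by
    have := hvc 0 (left_mem_Icc.2 hR.le)
    rw [ContinuousWithinAt, nhdsWithin_Icc_eq_nhdsGE hR] at this
    exact this.mono_left (nhdsWithin_mono _ Ioi_subset_Ici_self)
  have hlim : Tendsto (fun ε => lamStar + C * (v ε / Real.log (oneAddLog R ε)))
      (nhdsWithin 0 (Ioi 0)) (nhds lamStar) := by
    simpa using ((hvlim.div_atTop
      (Real.tendsto_log_atTop.comp (tendsto_oneAddLog_atTop R))).const_mul C).const_add lamStar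
  refine tendsto_of_tendsto_of_tendsto_of_le_of_le' tendsto_const_nhds hlim ?_ ?_
  · filter_upwards [Ioo_mem_nhdsGT hR] with ε hε using hlower ε hε
  · filter_upwards [Ioo_mem_nhdsGT hδ.1] with ε hε using hupper ε hε
end
end

section
/- Let k ≥ 0, N ≥ 3 and 1 ≤ p < N/2. Then γ_{p,k} = 0; that is, for every δ > 0 there exists a ∈ Γ_k ∩ L^p(B_1) with ‖a − μ_k‖_{L^p(B_1)} < δ. -/
open MeasureTheory Set Filter

noncomputable section

/-- A continuous cutoff equal to `1` up to `3ε` and vanishing from `4ε` on. -/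
def cutoff (ε s : ℝ) : ℝ := max 0 (min 1 (4 - s / ε))

/-- The flux profile `H`: it grows like `s ^ N` on `[0, ε]`, is constant on `[ε, 3ε]` and decays
linearly to zero on `[3ε, 4ε]`. -/
def flux (N : ℕ) (ε s : ℝ) : ℝ := min s ε ^ N * cutoff ε s

/-- The continuous extension to `ℝ` of `flux N ε s / s ^ (N - 1)`. -/
def fluxDensity (N : ℕ) (ε s : ℝ) : ℝ :=
  min s ε * (ε / max s ε) ^ (N - 1) * cutoff ε s

/-- The function `-H' / s ^ (N - 1)`, where `H = flux N ε`. -/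
def fluxSource (N : ℕ) (ε s : ℝ) : ℝ :=
  if 0 < s ∧ s < ε then -N else if 3 * ε < s ∧ s < 4 * ε then ε ^ (N - 1) / s ^ (N - 1) else 0

lemma cutoff_nonneg (ε s : ℝ) : 0 ≤ cutoff ε s := le_max_left _ _

lemma cutoff_eq_one {ε s : ℝ} (hε : 0 < ε) (hs : s ≤ 3 * ε) : cutoff ε s = 1 := by
  have h : s / ε ≤ 3 := by rwa [div_le_iff₀ hε]
  rw [cutoff, min_eq_left (by linarith), max_eq_right zero_le_one]

lemma cutoff_eq_zero {ε s : ℝ} (hε : 0 < ε) (hs : 4 * ε ≤ s) : cutoff ε s = 0 := by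
  have h : 4 ≤ s / ε := by rwa [le_div_iff₀ hε]
  exact max_eq_left ((min_le_right _ _).trans (by linarith))

lemma cutoff_eq_linear {ε s : ℝ} (hε : 0 < ε) (h₁ : 3 * ε ≤ s) (h₂ : s ≤ 4 * ε) :
    cutoff ε s = 4 - s / ε := by
  have h : s / ε ≤ 4 := by rwa [div_le_iff₀ hε]
  have h' : 3 ≤ s / ε := by rwa [le_div_iff₀ hε]
  rw [cutoff, min_eq_right (by linarith), max_eq_right (by linarith)]

lemma continuous_cutoff (ε : ℝ) : Continuous (cutoff ε) := by
  unfold cutoff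
  fun_prop

lemma continuous_flux (N : ℕ) (ε : ℝ) : Continuous (flux N ε) := by
  have := continuous_cutoff ε
  unfold flux
  fun_prop

lemma continuous_fluxDensity (N : ℕ) {ε : ℝ} (hε : 0 < ε) : Continuous (fluxDensity N ε) := by
  have := continuous_cutoff ε
  have h : ∀ s, max s ε ≠ 0 := fun s => (hε.trans_le (le_max_right s ε)).ne'
  unfold fluxDensity
  fun_prop (disch := exact h _)

lemma measurable_fluxSource (N : ℕ) (ε : ℝ) : Measurable (fluxSource N ε) := by
  unfold fluxSource
  refine Measurable.ite measurableSet_Ioo measurable_const (Measurable.ite measurableSet_Ioo ?_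
    measurable_const)
  fun_prop

lemma flux_zero {N : ℕ} (hN : N ≠ 0) {ε : ℝ} (hε : 0 < ε) : flux N ε 0 = 0 := by
  simp [flux, min_eq_left hε.le, hN]

lemma flux_eq_zero (N : ℕ) {ε s : ℝ} (hε : 0 < ε) (hs : 4 * ε ≤ s) : flux N ε s = 0 := by
  rw [flux, cutoff_eq_zero hε hs, mul_zero]

lemma fluxDensity_eq_zero (N : ℕ) {ε s : ℝ} (hε : 0 < ε) (hs : 4 * ε ≤ s) :
    fluxDensity N ε s = 0 := by
  rw [fluxDensity, cutoff_eq_zero hε hs, mul_zero]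

lemma fluxDensity_nonneg (N : ℕ) {ε s : ℝ} (hε : 0 < ε) (hs : 0 ≤ s) :
    0 ≤ fluxDensity N ε s := by
  have h : 0 < max s ε := hε.trans_le (le_max_right s ε)
  have h' : 0 ≤ min s ε := le_min hs hε.le
  have := cutoff_nonneg ε s
  unfold fluxDensity
  positivity

lemma le_fluxDensity (N : ℕ) {ε s : ℝ} (hε : 0 < ε) (h₁ : ε ≤ s) (h₂ : s ≤ 3 * ε) :
    ε / 3 ^ (N - 1) ≤ fluxDensity N ε s := by
  have hs : 0 < s := hε.trans_le h₁
  rw [fluxDensity, cutoff_eq_one hε h₂, min_eq_right h₁, max_eq_left h₁, mul_one,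
    div_eq_mul_one_div, ← one_div_pow]
  have h : 1 / 3 ≤ ε / s := by
    rw [div_le_div_iff₀ (by norm_num) hs]
    linarith
  gcongr

lemma pow_mul_fluxDensity {N : ℕ} (hN : N ≠ 0) {ε s : ℝ} (hε : 0 < ε) :
    s ^ (N - 1) * fluxDensity N ε s = flux N ε s := by
  have h : max s ε ≠ 0 := (hε.trans_le (le_max_right s ε)).ne'
  have e : s * (ε / max s ε) = min s ε := by
    rw [← mul_div_assoc, ← min_mul_max s ε, mul_div_cancel_right₀ _ h]
  obtain ⟨n, rfl⟩ := Nat.exists_eq_succ_of_ne_zero hN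
  simp only [fluxDensity, flux, Nat.succ_eq_add_one, Nat.add_sub_cancel]
  rw [← e]
  ring

lemma hasDerivAt_flux {N : ℕ} (hN : N ≠ 0) {ε s : ℝ} (hε : 0 < ε) (hs : 0 < s) (h₁ : s ≠ ε)
    (h₃ : s ≠ 3 * ε) (h₄ : s ≠ 4 * ε) :
    HasDerivAt (flux N ε) (-(fluxSource N ε s * s ^ (N - 1))) s := by
  rcases h₁.lt_or_gt with h | h
  · have e : flux N ε =ᶠ[nhds s] fun t => t ^ N := by
      filter_upwards [Iio_mem_nhds h] with t ht
      have ht : t < ε := ht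
      rw [flux, cutoff_eq_one hε (by linarith), min_eq_left ht.le, mul_one]
    rw [fluxSource, if_pos ⟨hs, h⟩, neg_mul, neg_neg]
    exact (hasDerivAt_pow N s).congr_of_eventuallyEq e
  rcases h₃.lt_or_gt with h' | h'
  · have e : flux N ε =ᶠ[nhds s] fun _ => ε ^ N := by
      filter_upwards [Iio_mem_nhds h', Ioi_mem_nhds h] with t ht ht'
      rw [flux, cutoff_eq_one hε (le_of_lt ht), min_eq_right (le_of_lt ht'), mul_one]
    rw [fluxSource, if_neg (by rintro ⟨-, h2⟩; linarith), if_neg (by rintro ⟨h2, -⟩; linarith),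
      zero_mul, neg_zero]
    exact (hasDerivAt_const s _).congr_of_eventuallyEq e
  rcases h₄.lt_or_gt with h'' | h''
  · have e : flux N ε =ᶠ[nhds s] fun t => ε ^ N * (4 - t / ε) := by
      filter_upwards [Iio_mem_nhds h'', Ioi_mem_nhds h', Ioi_mem_nhds h] with t ht ht' ht''
      rw [flux, cutoff_eq_linear hε (le_of_lt ht') (le_of_lt ht), min_eq_right (le_of_lt ht'')]
    rw [fluxSource, if_neg (by rintro ⟨-, h2⟩; linarith), if_pos ⟨h', h''⟩]
    have d := (((hasDerivAt_id s).div_const ε).const_sub 4).const_mul (ε ^ N)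
    refine (d.congr_of_eventuallyEq e).congr_deriv ?_
    obtain ⟨n, rfl⟩ := Nat.exists_eq_succ_of_ne_zero hN
    simp only [Nat.succ_eq_add_one, Nat.add_sub_cancel]
    field_simp
    ring
  · have e : flux N ε =ᶠ[nhds s] fun _ => 0 := by
      filter_upwards [Ioi_mem_nhds h''] with t ht
      exact flux_eq_zero N hε (le_of_lt ht)
    rw [fluxSource, if_neg (by rintro ⟨-, h2⟩; linarith), if_neg (by rintro ⟨-, h2⟩; linarith),
      zero_mul, neg_zero]
    exact (hasDerivAt_const s _).congr_of_eventuallyEq e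

/-- An eigenfunction with finitely many zeros in `(0,1)` does not vanish near the origin. -/
lemma exists_forall_ne_zero_near_zero {N : ℕ} {μ : ℝ} {φ : ℝ → ℝ} (hμ : 0 ≤ μ)
    (hφ : IsRadialNeumannSolution N (fun _ => μ) φ)
    (hfin : {x ∈ Ioo (0:ℝ) 1 | φ x = 0}.Finite) :
    ∃ ρ ∈ Ioo (0:ℝ) 1, ∀ x ∈ Icc (0:ℝ) ρ, φ x ≠ 0 := by
  obtain ⟨φ', hc, hd, hi, -⟩ := hφ
  have h0 : {x ∈ Ioo (0:ℝ) 1 | φ x = 0}ᶜ ∈ nhds (0:ℝ) :=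
    hfin.isClosed.isOpen_compl.mem_nhds (by simp)
  obtain ⟨η, hη, hball⟩ := Metric.mem_nhds_iff.1 h0
  have hρ0 : 0 < min η 1 / 2 := by positivity
  have hρ1 : min η 1 / 2 < 1 := by linarith [min_le_right η 1]
  have hρη : min η 1 / 2 < η := by linarith [min_le_left η 1, lt_min hη zero_lt_one]
  generalize min η 1 / 2 = ρ at hρ0 hρ1 hρη
  have hne : ∀ x ∈ Ioc (0:ℝ) ρ, φ x ≠ 0 := by
    intro x hx h
    have hxb : x ∈ Metric.ball (0:ℝ) η := by
      rw [Metric.mem_ball, dist_zero_right, Real.norm_eq_abs, abs_of_pos hx.1]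
      linarith [hx.2]
    exact hball hxb ⟨⟨hx.1, by linarith [hx.2]⟩, h⟩
  have hsign : ∀ x ∈ Ioc (0:ℝ) ρ, ∀ y ∈ Ioc (0:ℝ) ρ, 0 ≤ φ x * φ y := by
    intro x hx y hy
    by_contra! hlt
    have hcc : ContinuousOn φ (Ioc 0 ρ) :=
      hc.mono fun z hz => ⟨hz.1.le, by linarith [hz.2]⟩
    have hpre : IsPreconnected (Ioc (0:ℝ) ρ) := isPreconnected_Ioc
    rcases mul_neg_iff.1 hlt with ⟨h1, h2⟩ | ⟨h1, h2⟩
    · obtain ⟨z, hz, hz0⟩ := hpre.intermediate_value hy hx hcc ⟨h2.le, h1.le⟩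
      exact hne z hz hz0
    · obtain ⟨z, hz, hz0⟩ := hpre.intermediate_value hx hy hcc ⟨h1.le, h2.le⟩
      exact hne z hz hz0
  refine ⟨ρ, ⟨hρ0, hρ1⟩, fun x hx => ?_⟩
  rcases hx.1.eq_or_lt with rfl | hx0
  swap
  · exact hne x ⟨hx0, hx.2⟩
  intro hzero
  have hanti : AntitoneOn (fun r => φ r * φ r) (Icc 0 ρ) := by
    have hcc : ContinuousOn φ (Icc 0 ρ) := hc.mono (Icc_subset_Icc_right hρ1.le)
    refine antitoneOn_of_hasDerivWithinAt_nonpos (f' := fun r => φ' r * φ r + φ r * φ' r)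
      (convex_Icc 0 ρ) (hcc.mul hcc) (fun r hr => ?_) fun r hr => ?_
    · rw [interior_Icc] at hr
      have := hd r ⟨hr.1, by linarith [hr.2]⟩
      exact (this.mul this).hasDerivWithinAt
    · rw [interior_Icc] at hr
      have hpow : 0 < r ^ (N - 1) := pow_pos hr.1 _
      have hI : 0 ≤ (∫ s in (0:ℝ)..r, s ^ (N - 1) * μ * φ s) * φ r := by
        rw [← intervalIntegral.integral_mul_const]
        refine intervalIntegral.integral_nonneg_of_ae_restrict hr.1.le ?_
        rw [EventuallyLE, ← restrict_Ioc_eq_restrict_Icc, ae_restrict_iff' measurableSet_Ioc]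
        refine ae_of_all _ fun s hs => ?_
        have h1 := hsign s ⟨hs.1, hs.2.trans hr.2.le⟩ r ⟨hr.1, hr.2.le⟩
        have h2 : 0 ≤ s ^ (N - 1) * μ := mul_nonneg (pow_nonneg hs.1.le _) hμ
        simpa [mul_assoc] using mul_nonneg h2 h1
      have h1 := hi r ⟨hr.1, by linarith [hr.2]⟩
      have h2 : r ^ (N - 1) * (φ' r * φ r) ≤ 0 := by
        rw [← mul_assoc, h1]
        linarith
      have h3 : φ' r * φ r ≤ 0 := nonpos_of_mul_nonpos_right h2 hpow
      linarith [mul_comm (φ r) (φ' r)]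
  have h1 := hanti (left_mem_Icc.2 hρ0.le) (right_mem_Icc.2 hρ0.le) hρ0.le
  simp only [hzero, mul_zero] at h1
  exact hne ρ ⟨hρ0, le_rfl⟩ (mul_self_eq_zero.1 (le_antisymm h1 (mul_self_nonneg _)))

/-- Near the origin `φ ^ 2` agrees with a continuous weight on `ℝ` that is bounded above and
bounded away from zero. -/
lemma exists_weight {N : ℕ} {μ : ℝ} {φ : ℝ → ℝ} (hμ : 0 ≤ μ)
    (hφ : IsRadialNeumannSolution N (fun _ => μ) φ)
    (hfin : {x ∈ Ioo (0:ℝ) 1 | φ x = 0}.Finite) :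
    ∃ ρ ∈ Ioo (0:ℝ) 1, ∃ V : ℝ → ℝ, ∃ m M : ℝ, Continuous V ∧ 0 < m ∧
      (∀ s, m ≤ V s ∧ V s ≤ M) ∧ ∀ s ∈ Icc 0 ρ, V s = φ s ^ 2 := by
  obtain ⟨ρ, hρ, hne⟩ := exists_forall_ne_zero_near_zero hμ hφ hfin
  obtain ⟨φ', hc, -⟩ := hφ
  have hcc : ContinuousOn (fun s => φ s ^ 2) (Icc 0 ρ) :=
    (hc.mono (Icc_subset_Icc_right hρ.2.le)).pow 2
  have hnonempty : (Icc (0:ℝ) ρ).Nonempty := nonempty_Icc.2 hρ.1.le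
  obtain ⟨x, hx, hxmin⟩ := isCompact_Icc.exists_isMinOn hnonempty hcc
  obtain ⟨y, hy, hymax⟩ := isCompact_Icc.exists_isMaxOn hnonempty hcc
  refine ⟨ρ, hρ, IccExtend hρ.1.le ((Icc 0 ρ).domRestrict fun s => φ s ^ 2), φ x ^ 2, φ y ^ 2,
    hcc.domRestrict.Icc_extend', by have := hne x hx; positivity, fun s => ?_, fun s hs => ?_⟩
  · exact ⟨hxmin (projIcc 0 ρ hρ.1.le s).2, hymax (projIcc 0 ρ hρ.1.le s).2⟩
  · rw [IccExtend_of_mem _ _ hs, domRestrict_apply]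

/-- The increasing factor by which the eigenfunction is multiplied; it vanishes at `2ε`. -/
def growthFactor (N : ℕ) (ε : ℝ) (V : ℝ → ℝ) (r : ℝ) : ℝ :=
  ∫ s in (2 * ε)..r, fluxDensity N ε s / V s

section growthFactor

variable {N : ℕ} {ε m M : ℝ} {V : ℝ → ℝ}

lemma hasDerivAt_growthFactor (hε : 0 < ε) (hV : Continuous V) (hV0 : ∀ s, 0 < V s) (r : ℝ) :
    HasDerivAt (growthFactor N ε V) (fluxDensity N ε r / V r) r :=
  (((continuous_fluxDensity N hε).div₀ hV fun s => (hV0 s).ne').integral_hasStrictDerivAt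
    _ r).hasDerivAt

lemma continuous_growthFactor (hε : 0 < ε) (hV : Continuous V) (hV0 : ∀ s, 0 < V s) :
    Continuous (growthFactor N ε V) :=
  continuous_iff_continuousAt.2 fun r => (hasDerivAt_growthFactor hε hV hV0 r).continuousAt

lemma monotoneOn_growthFactor (hε : 0 < ε) (hV : Continuous V) (hV0 : ∀ s, 0 < V s) :
    MonotoneOn (growthFactor N ε V) (Ici 0) := by
  refine monotoneOn_of_hasDerivWithinAt_nonneg (convex_Ici 0)
    (continuous_growthFactor hε hV hV0).continuousOn
    (fun r _ => (hasDerivAt_growthFactor hε hV hV0 r).hasDerivWithinAt) fun r hr => ?_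
  exact div_nonneg (fluxDensity_nonneg N hε (interior_subset hr)) (hV0 r).le

lemma le_integral_fluxDensity_div (hε : 0 < ε) (hV : Continuous V) (hV0 : ∀ s, 0 < V s)
    (hVM : ∀ s, V s ≤ M) {x : ℝ} (h₁ : ε ≤ x) (h₂ : x + ε ≤ 3 * ε) :
    ε ^ 2 / (3 ^ (N - 1) * M) ≤ ∫ s in x..(x + ε), fluxDensity N ε s / V s := by
  have hM : 0 < M := (hV0 0).trans_le (hVM 0)
  have hc : Continuous fun s => fluxDensity N ε s / V s :=
    (continuous_fluxDensity N hε).div₀ hV fun s => (hV0 s).ne'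
  have h := intervalIntegral.integral_mono_on (μ := volume) (a := x) (b := x + ε)
    (f := fun _ => ε / 3 ^ (N - 1) / M) (by linarith)
    (continuous_const.intervalIntegrable _ _) (hc.intervalIntegrable _ _) fun s hs =>
      div_le_div₀ (fluxDensity_nonneg N hε (by linarith [hs.1]))
        (le_fluxDensity N hε (by linarith [hs.1]) (by linarith [hs.2])) (hV0 s) (hVM s)
  refine le_trans (le_of_eq ?_) h
  rw [intervalIntegral.integral_const, smul_eq_mul]
  field_simp
  ring

lemma growthFactor_le (hε : 0 < ε) (hV : Continuous V) (hV0 : ∀ s, 0 < V s)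
    (hVM : ∀ s, V s ≤ M) {s : ℝ} (hs : 0 ≤ s) (hsε : s ≤ ε) :
    growthFactor N ε V s ≤ -(ε ^ 2 / (3 ^ (N - 1) * M)) := by
  refine (monotoneOn_growthFactor hε hV hV0 hs hε.le hsε).trans ?_
  have h := le_integral_fluxDensity_div (N := N) hε hV hV0 hVM le_rfl (by linarith)
  rw [growthFactor, intervalIntegral.integral_symm, neg_le_neg_iff, two_mul]
  exact h

lemma le_growthFactor (hε : 0 < ε) (hV : Continuous V) (hV0 : ∀ s, 0 < V s)
    (hVM : ∀ s, V s ≤ M) {s : ℝ} (hs : 3 * ε ≤ s) :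
    ε ^ 2 / (3 ^ (N - 1) * M) ≤ growthFactor N ε V s := by
  refine le_trans ?_ (monotoneOn_growthFactor hε hV hV0 (a := 3 * ε)
    (by simp [hε.le]) (by simp only [mem_Ici]; linarith) hs)
  have h := le_integral_fluxDensity_div (N := N) hε hV hV0 hVM (x := 2 * ε) (by linarith)
    (by linarith)
  rwa [show 2 * ε + ε = 3 * ε by ring] at h

/-- The nonnegative perturbation added to the eigenvalue. -/
def bump (N : ℕ) (ε : ℝ) (V : ℝ → ℝ) (s : ℝ) : ℝ :=
  fluxSource N ε s / (V s * growthFactor N ε V s)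

lemma measurable_bump (hε : 0 < ε) (hV : Continuous V) (hV0 : ∀ s, 0 < V s) :
    Measurable (bump N ε V) :=
  (measurable_fluxSource N ε).div
    (hV.mul (continuous_growthFactor hε hV hV0)).measurable

lemma bump_eq_zero (hε : 0 < ε) {s : ℝ} (hs : 4 * ε ≤ s) : bump N ε V s = 0 := by
  rw [bump, fluxSource, if_neg (by rintro ⟨-, h⟩; linarith), if_neg (by rintro ⟨-, h⟩; linarith),
    zero_div]

lemma bump_pos (hN : N ≠ 0) (hε : 0 < ε) (hV : Continuous V) (hV0 : ∀ s, 0 < V s)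
    (hVM : ∀ s, V s ≤ M) {s : ℝ} (hs : 0 < s) (hsε : s < ε) : 0 < bump N ε V s := by
  have hM : 0 < M := (hV0 0).trans_le (hVM 0)
  have h := growthFactor_le (N := N) hε hV hV0 hVM hs.le hsε.le
  have hκ : 0 < ε ^ 2 / (3 ^ (N - 1) * M) := by positivity
  rw [bump, fluxSource, if_pos ⟨hs, hsε⟩]
  have : (0:ℝ) < N := by positivity
  exact div_pos_of_neg_of_neg (by linarith) (mul_neg_of_pos_of_neg (hV0 s) (by linarith))

lemma bump_nonneg_and_le (hN : N ≠ 0) (hε : 0 < ε) (hV : Continuous V) (hm : 0 < m)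
    (hVm : ∀ s, m ≤ V s ∧ V s ≤ M) (s : ℝ) :
    0 ≤ bump N ε V s ∧ bump N ε V s ≤ N * 3 ^ (N - 1) * M / m / ε ^ 2 := by
  have hV0 : ∀ s, 0 < V s := fun s => hm.trans_le (hVm s).1
  have hVM : ∀ s, V s ≤ M := fun s => (hVm s).2
  have hM : 0 < M := (hV0 0).trans_le (hVM 0)
  have hκ : 0 < ε ^ 2 / (3 ^ (N - 1) * M) := by positivity
  have hN1 : (1:ℝ) ≤ N := by exact_mod_cast Nat.one_le_iff_ne_zero.2 hN
  have hC : N * 3 ^ (N - 1) * M / m / ε ^ 2 = N / (m * (ε ^ 2 / (3 ^ (N - 1) * M))) := by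
    field_simp
  rw [hC]
  by_cases h1 : 0 < s ∧ s < ε
  · refine ⟨(bump_pos hN hε hV hV0 hVM h1.1 h1.2).le, ?_⟩
    have h := growthFactor_le (N := N) hε hV hV0 hVM h1.1.le h1.2.le
    have hg : ε ^ 2 / (3 ^ (N - 1) * M) ≤ -growthFactor N ε V s := by linarith
    rw [bump, fluxSource, if_pos h1, neg_div, ← div_neg, ← mul_neg]
    exact div_le_div_of_nonneg_left (by positivity) (by positivity)
      (mul_le_mul (hVm s).1 hg hκ.le (hV0 s).le)
  by_cases h2 : 3 * ε < s ∧ s < 4 * ε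
  · have h := le_growthFactor (N := N) hε hV hV0 hVM h2.1.le
    have hs : 0 < s := by linarith [h2.1]
    have hg : 0 < growthFactor N ε V s := by linarith
    have hVs := hV0 s
    rw [bump, fluxSource, if_neg h1, if_pos h2]
    refine ⟨by positivity, ?_⟩
    gcongr
    · refine (div_le_one_of_le₀ ?_ (by positivity)).trans hN1
      exact pow_le_pow_left₀ hε.le (by linarith) _
    · exact (hVm s).1
  · rw [bump, fluxSource, if_neg h1, if_neg h2, zero_div]
    exact ⟨le_rfl, by positivity⟩

lemma bump_mul_growthFactor (hε : 0 < ε) (hV : Continuous V) (hV0 : ∀ s, 0 < V s)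
    (hVM : ∀ s, V s ≤ M) (s : ℝ) :
    bump N ε V s * growthFactor N ε V s = fluxSource N ε s / V s := by
  have hM : 0 < M := (hV0 0).trans_le (hVM 0)
  have hκ : 0 < ε ^ 2 / (3 ^ (N - 1) * M) := by positivity
  have hVs := (hV0 s).ne'
  by_cases h1 : 0 < s ∧ s < ε
  · have h := growthFactor_le (N := N) hε hV hV0 hVM h1.1.le h1.2.le
    have hg : growthFactor N ε V s ≠ 0 := by linarith
    rw [bump]
    field_simp
  by_cases h2 : 3 * ε < s ∧ s < 4 * ε
  · have h := le_growthFactor (N := N) hε hV hV0 hVM h2.1.le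
    have hg : growthFactor N ε V s ≠ 0 := by linarith
    rw [bump]
    field_simp
  · simp [bump, fluxSource, if_neg h1, if_neg h2]

end growthFactor

lemma isRadialNeumannSolution_mul_growthFactor {N : ℕ} (hN : 2 ≤ N) {ε ρ M μ : ℝ} {V φ : ℝ → ℝ}
    (hφ : IsRadialNeumannSolution N (fun _ => μ) φ) (hε : 0 < ε) (hερ : 4 * ε < ρ) (hρ : ρ < 1)
    (hV : Continuous V) (hV0 : ∀ s, 0 < V s) (hVM : ∀ s, V s ≤ M)
    (hVφ : ∀ s ∈ Icc 0 ρ, V s = φ s ^ 2) (hab : ∃ B, ∀ s, |bump N ε V s| ≤ B) :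
    IsRadialNeumannSolution N (fun s => μ + bump N ε V s)
      (fun s => φ s * growthFactor N ε V s) := by
  obtain ⟨φ', hc, hd, hi, h1⟩ := hφ
  have hN0 : N ≠ 0 := by omega
  have hgd := hasDerivAt_growthFactor (N := N) hε hV hV0
  have hgc := continuous_growthFactor (N := N) hε hV hV0
  refine ⟨fun r => φ' r * growthFactor N ε V r + φ r * (fluxDensity N ε r / V r),
    hc.mul hgc.continuousOn, fun r hr => (hd r hr).mul (hgd r), fun r hr => ?_, ?_⟩
  swap
  · simp only [h1, zero_mul, zero_add]
    rw [fluxDensity_eq_zero N hε (by linarith), zero_div, mul_zero]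
  have hsub : Icc (0:ℝ) r ⊆ Icc 0 1 := Icc_subset_Icc_right hr.2
  set P : ℝ → ℝ := fun t => ∫ s in (0:ℝ)..t, s ^ (N - 1) * μ * φ s with hP
  have hPi : ContinuousOn (fun s => s ^ (N - 1) * μ * φ s) (Icc 0 1) := by fun_prop
  have hPc : ContinuousOn P (Icc 0 1) := by
    have := intervalIntegral.continuousOn_primitive_interval (μ := volume)
      (f := fun s => s ^ (N - 1) * μ * φ s) (a := 0) (b := 1)
      (by rw [uIcc_of_le zero_le_one]; exact hPi.integrableOn_Icc)
    rwa [uIcc_of_le zero_le_one] at this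
  have hPd : ∀ t ∈ Ioo (0:ℝ) 1, HasDerivAt P (t ^ (N - 1) * μ * φ t) t := by
    intro t ht
    have hn : Icc (0:ℝ) 1 ∈ nhds t := Icc_mem_nhds ht.1 ht.2
    refine intervalIntegral.integral_hasDerivAt_right ?_ ?_ (hPi.continuousAt hn)
    · refine ContinuousOn.intervalIntegrable ?_
      rw [uIcc_of_le ht.1.le]
      exact hPi.mono (Icc_subset_Icc_right ht.2.le)
    · exact ⟨Icc 0 1, hn, hPi.aestronglyMeasurable measurableSet_Icc⟩
  set F : ℝ → ℝ := fun t => -P t * growthFactor N ε V t + flux N ε t * φ t / V t with hF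
  have hFc : ContinuousOn F (Icc 0 1) := by
    have := (continuous_flux N ε).continuousOn (s := Icc 0 1)
    exact (hPc.neg.mul hgc.continuousOn).add
      ((this.mul hc).div hV.continuousOn fun s _ => (hV0 s).ne')
  have hF0 : F 0 = 0 := by simp [hF, hP, flux_zero hN0 hε]
  have hFr : F r = r ^ (N - 1) *
      (φ' r * growthFactor N ε V r + φ r * (fluxDensity N ε r / V r)) := by
    have h2 : -P r = r ^ (N - 1) * φ' r := (hi r hr).symm
    simp only [hF]
    rw [h2, ← pow_mul_fluxDensity hN0 hε]
    ring
  set f : ℝ → ℝ := fun s =>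
    -(s ^ (N - 1) * (μ + bump N ε V s) * (φ s * growthFactor N ε V s)) with hf
  have hFd : ∀ t ∈ Ioo 0 r \ {ε, 3 * ε, 4 * ε}, HasDerivAt F (f t) t := by
    rintro t ⟨ht, hne⟩
    simp only [mem_insert_iff, mem_singleton_iff, not_or] at hne
    have htI : t ∈ Ioo (0:ℝ) 1 := ⟨ht.1, ht.2.trans_le hr.2⟩
    have dP := (hPd t htI).neg.mul (hgd t)
    have dH := hasDerivAt_flux hN0 hε ht.1 hne.1 hne.2.1 hne.2.2
    have hb := bump_mul_growthFactor (N := N) hε hV hV0 hVM t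
    rcases lt_or_ge t ρ with htρ | htρ
    · have hVt := hVφ t ⟨ht.1.le, htρ.le⟩
      have hφt : φ t ≠ 0 := by
        intro h
        have := hV0 t
        rw [hVt, h] at this
        norm_num at this
      have e : F =ᶠ[nhds t] fun t => -P t * growthFactor N ε V t + flux N ε t / φ t := by
        filter_upwards [Ioo_mem_nhds ht.1 htρ] with s hs
        have hVs := hVφ s ⟨hs.1.le, hs.2.le⟩
        have hφs : φ s ≠ 0 := by
          intro h
          have := hV0 s
          rw [hVs, h] at this
          norm_num at this
        simp only [hF, hVs]
        field_simp
      have d := dP.add (dH.div (hd t ⟨ht.1, htI.2.le⟩) hφt)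
      refine (d.congr_of_eventuallyEq e).congr_deriv ?_
      have h2 : -P t = t ^ (N - 1) * φ' t := (hi t ⟨ht.1, htI.2.le⟩).symm
      have h3 : f t = -(t ^ (N - 1) * μ * φ t * growthFactor N ε V t
          + t ^ (N - 1) * φ t * (fluxSource N ε t / V t)) := by
        rw [← hb]
        ring
      simp only [Pi.neg_apply]
      rw [h3, h2, ← pow_mul_fluxDensity hN0 hε, hVt]
      field_simp
      ring
    · have e : F =ᶠ[nhds t] fun t => -P t * growthFactor N ε V t := by
        filter_upwards [Ioi_mem_nhds (hερ.trans_le htρ)] with s hs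
        simp only [hF]
        rw [flux_eq_zero N hε (le_of_lt hs)]
        simp
      refine (dP.congr_of_eventuallyEq e).congr_deriv ?_
      have h4 : 4 * ε ≤ t := by linarith
      simp only [hf]
      rw [bump_eq_zero hε h4, fluxDensity_eq_zero N hε h4]
      ring
  have hfi : IntervalIntegrable f volume 0 r := by
    obtain ⟨B, hB⟩ := hab
    have h2 : IntegrableOn (fun s => -(s ^ (N - 1) * (φ s * growthFactor N ε V s)))
        (Icc 0 1) := by
      refine ContinuousOn.integrableOn_Icc ?_
      have := hgc.continuousOn (s := Icc 0 1)
      fun_prop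
    have h3 : IntegrableOn (fun s => (μ + bump N ε V s) *
        -(s ^ (N - 1) * (φ s * growthFactor N ε V s))) (Icc 0 1) := by
      refine Integrable.bdd_mul (c := |μ| + B) h2
        ((measurable_const.add (measurable_bump hε hV hV0)).aestronglyMeasurable)
        (ae_of_all _ fun s => ?_)
      exact (norm_add_le _ _).trans (add_le_add le_rfl (hB s))
    rw [intervalIntegrable_iff_integrableOn_Icc_of_le hr.1.le]
    refine (h3.mono_set hsub).congr_fun (fun s _ => ?_) measurableSet_Icc
    simp only [hf]
    ring
  have key := integral_eq_of_hasDerivAt_off_countable_of_le F f hr.1.le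
    (s := {ε, 3 * ε, 4 * ε}) (by simp) (hFc.mono hsub) hFd hfi
  rw [hF0, sub_zero, hFr] at key
  rw [← key, hf, intervalIntegral.integral_neg]

lemma radialMemLp_of_bounded (N : ℕ) {q B : ℝ} {a : ℝ → ℝ} (hq : 0 ≤ q) (ha : Measurable a)
    (hB : ∀ s, |a s| ≤ B) : RadialMemLp N q a := by
  refine Measure.integrableOn_of_bounded (M := B ^ q) (by simp)
    (by fun_prop : Measurable fun r => r ^ (N - 1) * |a r| ^ q).aestronglyMeasurable ?_
  refine (ae_restrict_iff' measurableSet_Ioo).2 (ae_of_all _ fun r hr => ?_)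
  have h1 : r ^ (N - 1) ≤ 1 := pow_le_one₀ hr.1.le hr.2.le
  have h2 : |a r| ^ q ≤ B ^ q := Real.rpow_le_rpow (abs_nonneg _) (hB r) hq
  have h3 : 0 ≤ r ^ (N - 1) := pow_nonneg hr.1.le _
  have h4 : 0 ≤ |a r| ^ q := by positivity
  rw [Real.norm_of_nonneg (by positivity)]
  calc r ^ (N - 1) * |a r| ^ q ≤ 1 * |a r| ^ q := by gcongr
    _ ≤ B ^ q := by rwa [one_mul]

lemma omegaN_nonneg (N : ℕ) : 0 ≤ omegaN N := by
  unfold omegaN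
  positivity

lemma integral_pow_mul_abs_rpow_nonneg (N : ℕ) (p : ℝ) (a : ℝ → ℝ) :
    0 ≤ ∫ r in (0:ℝ)..1, r ^ (N - 1) * |a r| ^ p :=
  intervalIntegral.integral_nonneg zero_le_one fun r hr =>
    mul_nonneg (pow_nonneg hr.1 _) (by positivity)

lemma radialLpNorm_nonneg (N : ℕ) (p : ℝ) (a : ℝ → ℝ) : 0 ≤ radialLpNorm N p a :=
  Real.rpow_nonneg (mul_nonneg (omegaN_nonneg N) (integral_pow_mul_abs_rpow_nonneg N p a)) _

lemma radialLpNorm_le_of_eq_zero {N : ℕ} (hN : N ≠ 0) {p R B : ℝ} {a : ℝ → ℝ} (hp : 0 < p)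
    (ha : Measurable a) (hB : ∀ s, |a s| ≤ B) (hR : 0 ≤ R) (hR1 : R ≤ 1)
    (ha0 : ∀ s, R ≤ s → a s = 0) :
    radialLpNorm N p a ≤ (omegaN N * (R ^ N * B ^ p)) ^ (1 / p) := by
  refine Real.rpow_le_rpow (mul_nonneg (omegaN_nonneg N) (integral_pow_mul_abs_rpow_nonneg N p a))
    (mul_le_mul_of_nonneg_left ?_ (omegaN_nonneg N)) (by positivity)
  have hint : IntervalIntegrable (fun r => r ^ (N - 1) * |a r| ^ p) volume 0 1 := by
    rw [intervalIntegrable_iff_integrableOn_Ioo_of_le zero_le_one]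
    exact radialMemLp_of_bounded N hp.le ha hB
  have hRI : R ∈ uIcc (0:ℝ) 1 := by rw [uIcc_of_le zero_le_one]; exact ⟨hR, hR1⟩
  have hzero : ∫ r in R..1, r ^ (N - 1) * |a r| ^ p = 0 := by
    refine intervalIntegral.integral_zero_ae (ae_of_all _ fun r hr => ?_)
    rw [uIoc_of_le hR1] at hr
    rw [ha0 r hr.1.le, abs_zero, Real.zero_rpow hp.ne', mul_zero]
  rw [← intervalIntegral.integral_add_adjacent_intervals
    (hint.mono_set (uIcc_subset_uIcc_left hRI)) (hint.mono_set (uIcc_subset_uIcc_right hRI)),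
    hzero, add_zero]
  have h := intervalIntegral.norm_integral_le_of_norm_le_const (a := 0) (b := R)
    (f := fun r => r ^ (N - 1) * |a r| ^ p) (C := R ^ (N - 1) * B ^ p) fun r hr => by
      rw [uIoc_of_le hR] at hr
      have h1 : r ^ (N - 1) ≤ R ^ (N - 1) := pow_le_pow_left₀ hr.1.le hr.2 _
      have h2 : |a r| ^ p ≤ B ^ p := Real.rpow_le_rpow (abs_nonneg _) (hB r) hp.le
      have h3 : 0 ≤ r ^ (N - 1) := pow_nonneg hr.1.le _
      rw [Real.norm_of_nonneg (by positivity)]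
      gcongr
  refine (le_abs_self _).trans (h.trans (le_of_eq ?_))
  rw [sub_zero, abs_of_nonneg hR, mul_right_comm, pow_sub_one_mul hN]

lemma tendsto_concentration_bound {N : ℕ} {p : ℝ} (hp : 0 < p) (hpN : p < (N : ℝ) / 2)
    {C : ℝ} (hC : 0 ≤ C) :
    Tendsto (fun ε : ℝ => (omegaN N * ((4 * ε) ^ N * (C / ε ^ 2) ^ p)) ^ (1 / p))
      (nhdsWithin 0 (Ioi 0)) (nhds 0) := by
  have hθ : 0 < (N : ℝ) - 2 * p := by linarith
  have h1 : Tendsto (fun ε : ℝ => (omegaN N * (4 ^ N * C ^ p * ε ^ ((N : ℝ) - 2 * p))) ^ (1 / p))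
      (nhds 0) (nhds 0) := by
    have hc : Continuous fun ε : ℝ =>
        (omegaN N * (4 ^ N * C ^ p * ε ^ ((N : ℝ) - 2 * p))) ^ (1 / p) :=
      (continuous_const.mul (continuous_const.mul
        (Real.continuous_rpow_const hθ.le))).rpow_const fun _ => Or.inr (by positivity)
    convert hc.tendsto 0 using 2
    rw [Real.zero_rpow hθ.ne', mul_zero, mul_zero, Real.zero_rpow (by positivity)]
  refine (h1.mono_left nhdsWithin_le_nhds).congr' ?_
  filter_upwards [self_mem_nhdsWithin] with ε hε
  have hε : 0 < ε := hε
  have h2 : (ε ^ 2) ^ p = ε ^ (2 * p) := by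
    rw [← Real.rpow_natCast, ← Real.rpow_mul hε.le]
    norm_num
  rw [Real.div_rpow hC (by positivity), h2, mul_pow, Real.rpow_sub hε, Real.rpow_natCast]
  congr 2
  ring

lemma gammaSet_add_bump {N : ℕ} (hN : 3 ≤ N) {ε ρ m M μ : ℝ} {V φ : ℝ → ℝ}
    (hφ : IsRadialNeumannSolution N (fun _ => μ) φ) (hε : 0 < ε) (hερ : 4 * ε < ρ) (hρ : ρ < 1)
    (hV : Continuous V) (hm : 0 < m) (hVm : ∀ s, m ≤ V s ∧ V s ≤ M)
    (hVφ : ∀ s ∈ Icc 0 ρ, V s = φ s ^ 2) :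
    GammaSet N μ (fun s => μ + bump N ε V s) := by
  have hN0 : N ≠ 0 := by omega
  have hV0 : ∀ s, 0 < V s := fun s => hm.trans_le (hVm s).1
  have hVM : ∀ s, V s ≤ M := fun s => (hVm s).2
  have hb := bump_nonneg_and_le hN0 hε hV hm hVm
  have hbabs : ∀ s, |bump N ε V s| ≤ N * 3 ^ (N - 1) * M / m / ε ^ 2 := fun s => by
    rw [abs_of_nonneg (hb s).1]
    exact (hb s).2
  have hmeas : Measurable fun s => μ + bump N ε V s :=
    measurable_const.add (measurable_bump hε hV hV0)
  refine ⟨hmeas, ⟨ae_of_all _ fun r => by linarith [(hb r).1], ?_⟩,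
    ⟨_, isRadialNeumannSolution_mul_growthFactor (by omega) hφ hε hερ hρ hV hV0 hVM hVφ
      ⟨_, hbabs⟩, 3 * ε, ⟨by positivity, by linarith⟩, ?_⟩, ?_⟩
  · have hvol : 0 < volume (Ioo 0 ε) := by simpa using hε
    refine hvol.trans_le (measure_mono fun s hs => ⟨⟨hs.1, by linarith [hs.2]⟩, ?_⟩)
    have := bump_pos hN0 hε hV hV0 hVM hs.1 hs.2
    simp only
    linarith
  · have hM : 0 < M := (hV0 0).trans_le (hVM 0)
    have hg := le_growthFactor (N := N) hε hV hV0 hVM (le_refl (3 * ε))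
    have hκ : 0 < ε ^ 2 / (3 ^ (N - 1) * M) := by positivity
    refine mul_ne_zero (fun h => ?_) (hκ.trans_le hg).ne'
    have h1 := hV0 (3 * ε)
    rw [hVφ (3 * ε) ⟨by positivity, by linarith⟩, h] at h1
    norm_num at h1
  · rw [if_pos hN]
    exact radialMemLp_of_bounded N (by positivity) hmeas fun s =>
      (abs_add_le _ _).trans (add_le_add le_rfl (hbabs s))

/-- The subcritical case for `N ≥ 3`: if `1 ≤ p < N/2` then `γ_{p,k} = 0`,
i.e. for every `δ > 0` there is `a ∈ Γ_k ∩ L^p(B_1)` with `‖a - μ_k‖_{L^p(B_1)} < δ`. -/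
theorem stmt10 (N k : ℕ) (hN : 3 ≤ N) (p : ℝ) (hp1 : 1 ≤ p) (hp2 : p < (N : ℝ) / 2)
    (μk : ℝ) (φk : ℝ → ℝ) (rz : ℕ → ℝ)
    (hek : IsRadialNeumannEigenpair N k μk φk rz) :
    gammaLyap N μk p = 0 ∧
    ∀ δ : ℝ, 0 < δ → ∃ a : ℝ → ℝ, GammaSet N μk a ∧ RadialMemLp N p a ∧
      radialLpNorm N p (fun r => a r - μk) < δ := by
  have hp : 0 < p := by linarith
  have hN0 : N ≠ 0 := by omega
  have key : ∀ δ : ℝ, 0 < δ → ∃ a : ℝ → ℝ, GammaSet N μk a ∧ RadialMemLp N p a ∧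
      radialLpNorm N p (fun r => a r - μk) < δ := by
    intro δ hδ
    obtain ⟨hμ, hφ, -, -, -, hz, -⟩ := hek
    have hfin : {x ∈ Ioo (0:ℝ) 1 | φk x = 0}.Finite := by
      refine ((Set.finite_Icc 1 k).image rz).subset ?_
      rintro x ⟨hx, hx0⟩
      obtain ⟨i, h1, h2, rfl⟩ := (hz x hx).1 hx0
      exact ⟨i, ⟨h1, h2⟩, rfl⟩
    obtain ⟨ρ, hρ, V, m, M, hV, hm, hVm, hVφ⟩ := exists_weight hμ hφ hfin
    have hV0 : ∀ s, 0 < V s := fun s => hm.trans_le (hVm s).1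
    have hM : 0 < M := (hV0 0).trans_le (hVm 0).2
    have hC : 0 ≤ N * 3 ^ (N - 1) * M / m := by positivity
    obtain ⟨ε, hεδ, hε⟩ := (((tendsto_concentration_bound hp hp2 hC).eventually
      (gt_mem_nhds hδ)).and (Ioo_mem_nhdsGT (show (0:ℝ) < ρ / 4 by linarith [hρ.1]))).exists
    have hερ : 4 * ε < ρ := by linarith [hε.2]
    have hb := bump_nonneg_and_le hN0 hε.1 hV hm hVm
    have hbabs : ∀ s, |bump N ε V s| ≤ N * 3 ^ (N - 1) * M / m / ε ^ 2 := fun s => by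
      rw [abs_of_nonneg (hb s).1]
      exact (hb s).2
    have hmeas := measurable_bump (N := N) hε.1 hV hV0
    refine ⟨fun s => μk + bump N ε V s, gammaSet_add_bump hN hφ hε.1 hερ hρ.2 hV hm hVm hVφ,
      radialMemLp_of_bounded N hp.le (measurable_const.add hmeas) fun s =>
        (abs_add_le _ _).trans (add_le_add le_rfl (hbabs s)), ?_⟩
    simp only [add_sub_cancel_left]
    exact (radialLpNorm_le_of_eq_zero hN0 hp hmeas hbabs (by linarith [hε.1])
      (by linarith [hρ.2]) fun s hs => bump_eq_zero hε.1 hs).trans_lt hεδ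
  refine ⟨le_antisymm (le_of_forall_pos_lt_add fun δ hδ => ?_) ?_, key⟩
  · obtain ⟨a, ha, hap, hlt⟩ := key δ hδ
    rw [zero_add]
    refine lt_of_le_of_lt (csInf_le ⟨0, ?_⟩ ⟨a, ha, hap, rfl⟩) hlt
    rintro _ ⟨b, -, -, rfl⟩
    exact radialLpNorm_nonneg N p _
  · refine Real.sInf_nonneg ?_
    rintro _ ⟨b, -, -, rfl⟩
    exact radialLpNorm_nonneg N p _
end
end
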